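/- arXiv:2312.04955 — 3 statements merged into one kernel-verified Lean document; each statement's English description precedes it below -/
import Mathlib

section
/- Let q ≥ 3 be an integer and let L_q be a projective plane of order q, that is, a (q+1)-uniform hypergraph on q²+q+1 vertices in which every vertex lies in exactly q+1 edges and every pair of distinct vertices is contained in exactly one edge. Then, for every sufficiently large integer n, R(P_{n,q}^{(q+1)}, L_q) ≥ ⌊((q+2)/(q+1))·(n-1)⌋. -/
open scoped Classical

/-- There is a copy of the hypergraph with edge set `F` all of whose edges receive
colour `b` under the red/blue colouring `c` (`true` = red, `false` = blue) of the
complete hypergraph on the vertex type `V`. -/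
def hasMonoCopy {V W : Type*} [DecidableEq V] [DecidableEq W]
    (c : Finset V → Bool) (b : Bool) (F : Finset (Finset W)) : Prop :=
  ∃ f : W → V, Function.Injective f ∧ ∀ e ∈ F, c (e.image f) = b

/-- The Ramsey number of a pair of hypergraphs: the least `N` such that every
red/blue colouring of the complete hypergraph on `N` vertices contains a red copy
of `G` or a blue copy of `H`. -/
noncomputable def ramseyNumber {V W : Type*} [DecidableEq V] [DecidableEq W]
    (G : Finset (Finset V)) (H : Finset (Finset W)) : ℕ :=
  sInf {N : ℕ | ∀ c : Finset (Fin N) → Bool,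
    hasMonoCopy c true G ∨ hasMonoCopy c false H}

/-- `E` is a `k`-uniform hypergraph: every edge has exactly `k` vertices. -/
def IsUniformHyp {V : Type*} (k : ℕ) (E : Finset (Finset V)) : Prop :=
  ∀ e ∈ E, e.card = k
/-- The edge set of the `k`-uniform `ℓ`-path on `n` vertices `0, …, n-1`
(for `n ≡ ℓ (mod k-ℓ)`): the `i`-th edge consists of the vertices
`i(k-ℓ), …, i(k-ℓ)+k-1`. -/
def ellPathEdges (k ℓ n : ℕ) : Finset (Finset (Fin n)) :=
  (Finset.range ((n - ℓ) / (k - ℓ))).image (fun i =>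
    Finset.univ.filter (fun v : Fin n => i * (k - ℓ) ≤ (v : ℕ) ∧ (v : ℕ) < i * (k - ℓ) + k))


lemma ramsey_aux (k : ℕ) : ∀ m : ℕ, ∃ N : ℕ, ∀ X : Finset ℕ, N ≤ X.card → ∀ c : Finset ℕ → Bool,
    ∃ S ⊆ X, m ≤ S.card ∧ ∃ b, ∀ e ⊆ S, e.card = k → c e = b := by
  induction k with
  | zero =>
    intro m
    refine ⟨m, fun X hX c => ⟨X, subset_rfl, hX, c ∅, fun e _ he => ?_⟩⟩
    rw [Finset.card_eq_zero.mp he]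
  | succ k ih =>
    have key : ∀ t : ℕ, ∃ N : ℕ, ∀ X : Finset ℕ, N ≤ X.card → ∀ c : Finset ℕ → Bool,
        ∃ Y ⊆ X, t ≤ Y.card ∧ ∃ d : ℕ → Bool, ∀ a ∈ Y, ∀ e ⊆ Y, (∀ x ∈ e, a < x) →
          e.card = k → c (insert a e) = d a := by
      intro t
      induction t with
      | zero =>
        refine ⟨0, fun X _ c => ⟨∅, by simp, by simp, fun _ => true, by simp⟩⟩
      | succ t iht =>
        obtain ⟨Nt, hNt⟩ := iht
        obtain ⟨M, hM⟩ := ih Nt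
        refine ⟨M + 1, fun X hX c => ?_⟩
        have hne : X.Nonempty := Finset.card_pos.mp (by omega)
        set a := X.min' hne with ha
        have haX : a ∈ X := Finset.min'_mem _ _
        have hc : (X.erase a).card = X.card - 1 := Finset.card_erase_of_mem haX
        obtain ⟨S, hSX, hS, b, hb⟩ := hM (X.erase a) (by omega) (fun e => c (insert a e))
        obtain ⟨Y, hYS, hY, d, hd⟩ := hNt S hS c
        have hlt : ∀ y ∈ Y, a < y := by
          intro y hy
          have h1 := Finset.mem_erase.mp (hSX (hYS hy))
          exact lt_of_le_of_ne (Finset.min'_le _ _ h1.2) (Ne.symm h1.1)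
        have haY : a ∉ Y := fun h => lt_irrefl _ (hlt a h)
        refine ⟨insert a Y, ?_, ?_, fun x => if x = a then b else d x, ?_⟩
        · intro x hx
          rcases Finset.mem_insert.mp hx with rfl | hx
          · exact haX
          · exact Finset.mem_of_mem_erase (hSX (hYS hx))
        · rw [Finset.card_insert_of_notMem haY]; omega
        · intro x hx e he hxe hek
          have heY : e ⊆ Y := by
            intro y hy
            rcases Finset.mem_insert.mp (he hy) with h | h
            · have := hxe y hy
              rcases Finset.mem_insert.mp hx with h' | h'
              · omega
              · have := hlt x h'; omega
            · exact h
          rcases Finset.mem_insert.mp hx with h' | h'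
          · subst h'
            simpa using hb e (heY.trans hYS) hek
          · have := hlt x h'
            simp only [show x ≠ a by omega, if_false]
            exact hd x h' e heY hxe hek
    intro m
    obtain ⟨N, hN⟩ := key (2 * m)
    refine ⟨N, fun X hX c => ?_⟩
    obtain ⟨Y, hYX, hY, d, hd⟩ := hN X hX c
    have hsum := Finset.card_filter_add_card_filter_not (s := Y) (fun x => d x = true)
    have : ∃ b, m ≤ (Y.filter (fun x => d x = b)).card := by
      by_contra! hcon
      have h1 := hcon true
      have h2 := hcon false
      simp only [Bool.not_eq_true] at hsum
      omega
    obtain ⟨b, hb⟩ := this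
    refine ⟨_, (Finset.filter_subset _ _).trans hYX, hb, b, fun e he hek => ?_⟩
    have hne : e.Nonempty := Finset.card_pos.mp (by omega)
    have hm := Finset.min'_mem e hne
    have h1 := hd (e.min' hne) (Finset.filter_subset _ _ (he hm)) (e.erase (e.min' hne))
      ((Finset.erase_subset _ _).trans (he.trans (Finset.filter_subset _ _)))
      (fun x hx => Finset.min'_lt_of_mem_erase_min' _ _ hx)
      (by rw [Finset.card_erase_of_mem hm]; omega)
    rw [Finset.insert_erase hm] at h1
    rw [h1]
    exact (Finset.mem_filter.mp (he hm)).2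

lemma mono_of_homog {N w k : ℕ} (F : Finset (Finset (Fin w))) (hF : ∀ e ∈ F, e.card = k)
    (c : Finset (Fin N) → Bool) (b : Bool) (S : Finset ℕ) (hS : S ⊆ Finset.range N)
    (hw : w ≤ S.card)
    (h : ∀ e ⊆ S, e.card = k → c (Finset.univ.filter (fun v : Fin N => (v : ℕ) ∈ e)) = b) :
    hasMonoCopy c b F := by
  obtain ⟨T, hTS, hT⟩ := Finset.exists_subset_card_eq hw
  have hmem : ∀ i, T.orderEmbOfFin hT i ∈ S := fun i => hTS (Finset.orderEmbOfFin_mem T hT i)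
  have hinj : Function.Injective (fun i => T.orderEmbOfFin hT i) :=
    (T.orderEmbOfFin hT).injective
  refine ⟨fun i => ⟨T.orderEmbOfFin hT i, Finset.mem_range.mp (hS (hmem i))⟩, ?_, ?_⟩
  · intro i j hij
    exact hinj (by simpa using hij)
  · intro e he
    rw [← h (e.image (fun i => T.orderEmbOfFin hT i)) ?_ ?_]
    · congr 1
      ext v
      simp only [Finset.mem_image, Finset.mem_filter, Finset.mem_univ, true_and, Fin.ext_iff]
    · intro x hx
      obtain ⟨i, _, rfl⟩ := Finset.mem_image.mp hx
      exact hmem i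
    · rw [Finset.card_image_of_injective _ hinj, hF e he]

lemma path_uniform (q n : ℕ) : ∀ e ∈ ellPathEdges (q + 1) q n, e.card = q + 1 := by
  intro e he
  simp only [ellPathEdges, Finset.mem_image, Finset.mem_range] at he
  obtain ⟨i, hi, rfl⟩ := he
  simp only [show q + 1 - q = 1 by omega, Nat.div_one, mul_one] at hi ⊢
  rw [← Finset.card_image_of_injective _ Fin.val_injective]
  have : (Finset.univ.filter (fun v : Fin n => i ≤ (v : ℕ) ∧ (v : ℕ) < i + (q + 1))).image Fin.val
      = Finset.Ico i (i + (q + 1)) := by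
    ext x
    simp only [Finset.mem_image, Finset.mem_filter, Finset.mem_univ, true_and, Finset.mem_Ico]
    constructor
    · rintro ⟨v, hv, rfl⟩; exact hv
    · intro hx; exact ⟨⟨x, by omega⟩, hx, rfl⟩
  rw [this]; simp

lemma no_blue (q : ℕ) (hq : 3 ≤ q)
    (L : Finset (Finset (Fin (q ^ 2 + q + 1))))
    (hLu : IsUniformHyp (q + 1) L)
    (hpair : ∀ u v : Fin (q ^ 2 + q + 1), u ≠ v →
      (L.filter (fun e => u ∈ e ∧ v ∈ e)).card = 1)
    (S : Finset (Fin (q ^ 2 + q + 1))) (hS : ∀ e ∈ L, (e ∩ S).card = 1) : False := by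
  have hline : ∀ u v : Fin (q ^ 2 + q + 1), u ≠ v → ∃ e ∈ L, u ∈ e ∧ v ∈ e := by
    intro u v huv
    obtain ⟨e, he⟩ := Finset.card_pos.mp (by rw [hpair u v huv]; exact one_pos)
    exact ⟨e, Finset.mem_filter.mp he⟩
  have hS1 : ∀ u ∈ S, ∀ v ∈ S, u = v := by
    intro u hu v hv
    by_contra huv
    obtain ⟨e, he, h1, h2⟩ := hline u v huv
    exact huv (Finset.card_le_one.mp (hS e he).le u (by simp [*]) v (by simp [*]))
  have hq2 : 9 ≤ q ^ 2 := by nlinarith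
  -- every line contains some point `p` which is the only point of `S`
  obtain ⟨e0, he0, -⟩ := hline ⟨0, by omega⟩ ⟨1, by omega⟩ (by simp)
  obtain ⟨p, hp⟩ := Finset.card_pos.mp (by rw [hS e0 he0]; exact one_pos)
  have hpS := (Finset.mem_inter.mp hp).2
  have hall : ∀ e ∈ L, p ∈ e := by
    intro e he
    obtain ⟨r, hr⟩ := Finset.card_pos.mp (by rw [hS e he]; exact one_pos)
    rw [Finset.mem_inter] at hr
    rw [hS1 p hpS r hr.2]; exact hr.1
  -- `u ∈ e0`, `u ≠ p`, `v ∉ e0`: the line `uv` contains `p`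
  obtain ⟨u, hu, hup⟩ := Finset.exists_mem_ne (s := e0) (by rw [hLu e0 he0]; omega) p
  obtain ⟨v, hv⟩ : ∃ v, v ∉ e0 := by
    by_contra! hcon
    have : e0 = Finset.univ := Finset.eq_univ_iff_forall.mpr hcon
    have h2 := hLu e0 he0
    rw [this, Finset.card_univ, Fintype.card_fin] at h2
    omega
  obtain ⟨e1, he1, h1, h2⟩ := hline u v (fun h => hv (h ▸ hu))
  have := Finset.card_le_one.mp (hpair u p hup).le e0
    (Finset.mem_filter.mpr ⟨he0, hu, hall e0 he0⟩) e1
    (Finset.mem_filter.mpr ⟨he1, h1, hall e1 he1⟩)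
  exact hv (this ▸ h2)

lemma window (q n b : ℕ) (hn : q + 1 ≤ n) (B : ℕ → Prop)
    (hB : ((Finset.range n).filter B).card ≤ b) (hb : b < n / (q + 1))
    (hw : ∀ i, i + (q + 1) ≤ n → ((Finset.Ico i (i + (q + 1))).filter B).card ≠ 1) :
    ∀ i < n, ¬ B i := by
  -- some window avoids B
  have hex : ∃ i, i + (q + 1) ≤ n ∧ ∀ x, i ≤ x → x < i + (q + 1) → ¬ B x := by
    by_contra! hcon
    have h1 : ∀ j, j < n / (q + 1) → (q + 1) * j + (q + 1) ≤ n := by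
      intro j hj
      calc (q + 1) * j + (q + 1) = (q + 1) * (j + 1) := by ring
        _ ≤ (q + 1) * (n / (q + 1)) := Nat.mul_le_mul_left _ hj
        _ ≤ n := Nat.mul_div_le _ _
    have h2 : ∀ j, ∃ x, j < n / (q + 1) → x < n ∧ x / (q + 1) = j ∧ B x := by
      intro j
      by_cases hj : j < n / (q + 1)
      · obtain ⟨x, hx1, hx2, hx3⟩ := hcon _ (h1 j hj)
        refine ⟨x, fun _ => ⟨by have := h1 j hj; omega, ?_, hx3⟩⟩
        apply Nat.div_eq_of_lt_le
        · rw [mul_comm]; exact hx1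
        · calc x < (q + 1) * j + (q + 1) := hx2
            _ = _ := by ring
      · exact ⟨0, fun h => absurd h hj⟩
    choose g hg using h2
    have : (Finset.range (n / (q + 1))).card ≤ ((Finset.range n).filter B).card := by
      apply Finset.card_le_card_of_injOn g
      · intro j hj
        have := hg j (by simpa using hj)
        simp [this.1, this.2.2]
      · intro j hj j' hj' h
        have a1 := hg j (by simpa using hj)
        have a2 := hg j' (by simpa using hj')
        rw [← a1.2.1, ← a2.2.1, h]
    rw [Finset.card_range] at this
    omega
  -- if all elements of window B lie at one point z then not B z
  have hone : ∀ i z, i + (q + 1) ≤ n → (∀ x, i ≤ x → x < i + (q + 1) → x ≠ z → ¬ B x) →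
      ∀ x, i ≤ x → x < i + (q + 1) → ¬ B x := by
    intro i z hi h x hx1 hx2 hx3
    apply hw i hi
    have hxz : x = z := by by_contra hne; exact h x hx1 hx2 hne hx3
    subst hxz
    rw [Finset.card_eq_one]
    refine ⟨x, ?_⟩
    ext y
    simp only [Finset.mem_filter, Finset.mem_Ico, Finset.mem_singleton]
    constructor
    · rintro ⟨⟨h1, h2⟩, h3⟩
      by_contra hne; exact h y h1 h2 hne h3
    · rintro rfl; exact ⟨⟨hx1, hx2⟩, hx3⟩
  obtain ⟨i0, hi0, hP⟩ := hex
  have up : ∀ d, i0 + d + (q + 1) ≤ n → ∀ x, i0 + d ≤ x → x < i0 + d + (q + 1) → ¬ B x := by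
    intro d
    induction d with
    | zero => intro _; exact hP
    | succ d ih =>
      intro hd
      apply hone _ (i0 + d + (q + 1)) hd
      intro x h1 h2 h3
      exact ih (by omega) x (by omega) (by omega)
  have down : ∀ d, d ≤ i0 → ∀ x, i0 - d ≤ x → x < i0 - d + (q + 1) → ¬ B x := by
    intro d
    induction d with
    | zero => intro _; exact hP
    | succ d ih =>
      intro hd
      apply hone _ (i0 - (d + 1)) (by omega)
      intro x h1 h2 h3
      exact ih (by omega) x (by omega) (by omega)
  intro i hi
  by_cases h : i ≤ i0
  · exact down (i0 - i) (by omega) i (by omega) (by omega)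
  · by_cases h' : i + (q + 1) ≤ n
    · exact up (i - i0) (by omega) i (by omega) (by omega)
    · exact up (n - (q + 1) - i0) (by omega) i (by omega) (by omega)

/-- Corollary: for a projective plane `L` of order `q ≥ 3` and all large `n`,
`R(P_{n,q}^{(q+1)}, L) ≥ ⌊((q+2)/(q+1))(n-1)⌋`. -/
theorem proj_plane_lower (q : ℕ) (hq : 3 ≤ q)
    (L : Finset (Finset (Fin (q ^ 2 + q + 1))))
    (hLu : IsUniformHyp (q + 1) L)
    (hdeg : ∀ v : Fin (q ^ 2 + q + 1), (L.filter (fun e => v ∈ e)).card = q + 1)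
    (hpair : ∀ u v : Fin (q ^ 2 + q + 1), u ≠ v →
      (L.filter (fun e => u ∈ e ∧ v ∈ e)).card = 1) :
    ∃ n₀ : ℕ, ∀ n : ℕ, n₀ ≤ n →
      (q + 2) * (n - 1) / (q + 1) ≤ ramseyNumber (ellPathEdges (q + 1) q n) L := by
  refine ⟨q + 1, fun n hn => ?_⟩
  unfold ramseyNumber
  apply le_csInf
  · obtain ⟨N, hN⟩ := ramsey_aux (q + 1) (n + (q ^ 2 + q + 1))
    refine ⟨N, fun c => ?_⟩
    obtain ⟨S, hS, hcard, b, hb⟩ := hN (Finset.range N) (by simp)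
      (fun e => c (Finset.univ.filter (fun v : Fin N => (v : ℕ) ∈ e)))
    cases b with
    | true => exact Or.inl (mono_of_homog _ (path_uniform q n) c true S hS (by omega) hb)
    | false => exact Or.inr (mono_of_homog _ hLu c false S hS (by omega) hb)
  · intro N hN
    by_contra! hlt
    have hbound : N < (n - 1) + (n - 1) / (q + 1) := by
      have : (q + 2) * (n - 1) = (n - 1) + (n - 1) * (q + 1) := by ring
      rw [this, Nat.add_mul_div_right _ _ (by omega)] at hlt
      omega
    rcases hN (fun e => decide ((e.filter (fun v : Fin N => n - 1 ≤ (v : ℕ))).card ≠ 1)) with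
      ⟨f, hf, h⟩ | ⟨f, hf, h⟩
    · have hno := window q n (N - (n - 1)) hn (fun i => ∃ h : i < n, n - 1 ≤ (f ⟨i, h⟩ : ℕ))
        ?_ ?_ ?_
      · have : (Finset.univ : Finset (Fin n)).card ≤ (Finset.range (n - 1)).card := by
          apply Finset.card_le_card_of_injOn (fun i => (f i : ℕ))
          · intro i _
            have := hno i i.2
            simp only [not_exists, not_le] at this
            simpa using this i.2
          · intro i _ j _ hij
            exact hf (Fin.ext hij)
        simp at this
        omega
      · have : ((Finset.range n).filter (fun i => ∃ h : i < n, n - 1 ≤ (f ⟨i, h⟩ : ℕ))).card ≤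
            (Finset.Ico (n - 1) N).card := by
          apply Finset.card_le_card_of_injOn (fun i => if h : i < n then (f ⟨i, h⟩ : ℕ) else 0)
          · intro i hi
            simp only [Finset.coe_filter, Finset.mem_range, Set.mem_setOf_eq] at hi
            obtain ⟨hi, _, h2⟩ := hi
            simp [hi, h2]
          · intro i hi j hj hij
            simp only [Finset.coe_filter, Finset.mem_range, Set.mem_setOf_eq] at hi hj
            simp only [hi.1, hj.1, dif_pos] at hij
            simpa using hf (Fin.ext hij)
        simpa using this
      · have : (n - 1) / (q + 1) ≤ n / (q + 1) := Nat.div_le_div_right (by omega)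
        have : 0 < n / (q + 1) := Nat.div_pos hn (by omega)
        omega
      · intro i hi
        have h1 := h (Finset.univ.filter (fun v : Fin n => i ≤ (v : ℕ) ∧ (v : ℕ) < i + (q + 1))) (by
          simp only [ellPathEdges, Finset.mem_image, Finset.mem_range]
          refine ⟨i, ?_, ?_⟩
          · simp only [show q + 1 - q = 1 by omega, Nat.div_one]; omega
          · simp only [show q + 1 - q = 1 by omega, mul_one])
        rw [decide_eq_true_eq] at h1
        convert h1 using 1
        rw [Finset.filter_image, Finset.card_image_of_injective _ hf,
          ← Finset.card_image_of_injective _ Fin.val_injective]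
        congr 1
        ext x
        simp only [Finset.mem_image, Finset.mem_filter, Finset.mem_univ, true_and, Finset.mem_Ico]
        constructor
        · rintro ⟨h1, h2, h3⟩
          exact ⟨⟨x, h2⟩, ⟨h1, h3⟩, rfl⟩
        · rintro ⟨v, ⟨h1, h2⟩, rfl⟩
          exact ⟨h1, v.2, h2⟩
    · apply no_blue q hq L hLu hpair (Finset.univ.filter (fun w => n - 1 ≤ (f w : ℕ)))
      intro e he
      have h1 := h e he
      rw [decide_eq_false_iff_not, not_not, Finset.filter_image,
        Finset.card_image_of_injective _ hf] at h1
      refine Eq.trans (congrArg Finset.card ?_) h1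
      ext x
      simp
end

section
/- For all integers α ≥ k ≥ 2, we have α - 1 + (k-1)·⌊(α-1)/(k-1)⌋ ≤ τ(k,α) ≤ 2α - 2. -/
open scoped Classical

/-- The independence number of a hypergraph: the largest size of a vertex set
containing no edge. -/
noncomputable def indepNum {V : Type*} [Fintype V] (E : Finset (Finset V)) : ℕ :=
  Finset.sup (Finset.univ.filter (fun S : Finset V => ∀ e ∈ E, ¬ e ⊆ S)) Finset.card

/-- `E` contains no loose path of length two, i.e. no two (distinct) edges sharing
exactly one vertex. -/
def NoLoosePathTwo {V : Type*} [DecidableEq V] (E : Finset (Finset V)) : Prop :=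
  ∀ e ∈ E, ∀ f ∈ E, e ≠ f → (e ∩ f).card ≠ 1

/-- `τ(k, α)`: the largest `n` such that there is a `k`-uniform hypergraph on `n`
vertices with independence number less than `α` and no loose path of length two. -/
noncomputable def tauFn (k α : ℕ) : ℕ :=
  sSup {n : ℕ | ∃ E : Finset (Finset (Fin n)),
    IsUniformHyp k E ∧ indepNum E < α ∧ NoLoosePathTwo E}


lemma tb_color {V : Type*} [DecidableEq V] (E : Finset (Finset V)) (h2 : ∀ e ∈ E, 2 ≤ e.card)
    (hE : NoLoosePathTwo E) (U : Finset V) :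
    ∃ R B : Finset V, R ∪ B = U ∧ (∀ e ∈ E, ¬ e ⊆ R) ∧ (∀ e ∈ E, ¬ e ⊆ B) := by
  induction U using Finset.induction_on with
  | empty =>
    have h0 : ∀ e ∈ E, ¬ e ⊆ (∅ : Finset V) := by
      intro e he hs
      have := h2 e he
      rw [Finset.subset_empty.mp hs] at this
      simp at this
    exact ⟨∅, ∅, by simp, h0, h0⟩
  | insert v U hv ih =>
    obtain ⟨R, B, hU, hR, hB⟩ := ih
    by_cases h1 : ∀ e ∈ E, ¬ e ⊆ insert v R
    · exact ⟨insert v R, B, by rw [Finset.insert_union, hU], h1, hB⟩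
    by_cases h3 : ∀ e ∈ E, ¬ e ⊆ insert v (B \ R)
    · refine ⟨R, insert v (B \ R), ?_, hR, h3⟩
      rw [Finset.union_insert, Finset.union_sdiff_self_eq_union, hU]
    exfalso
    push Not at h1 h3
    obtain ⟨e, he, heR⟩ := h1
    obtain ⟨f, hf, hfB⟩ := h3
    have hve : v ∈ e := by
      by_contra h
      exact hR e he ((Finset.subset_insert_iff_of_notMem h).mp heR)
    have hvf : v ∈ f := by
      by_contra h
      exact hB f hf (((Finset.subset_insert_iff_of_notMem h).mp hfB).trans Finset.sdiff_subset)
    have hef : e ∩ f = {v} := by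
      ext x
      simp only [Finset.mem_inter, Finset.mem_singleton]
      constructor
      · rintro ⟨a, b⟩
        have a' := heR a
        have b' := hfB b
        simp only [Finset.mem_insert, Finset.mem_sdiff] at a' b'
        tauto
      · rintro rfl
        exact ⟨hve, hvf⟩
    by_cases hne : e = f
    · subst hne
      rw [Finset.inter_self] at hef
      have := h2 e he
      rw [hef] at this
      simp at this
    · have := hE e he f hf hne
      apply this
      have h4 : (e ∩ f).card = 1 := by rw [hef]; simp
      convert h4

lemma tb_le_indep {V : Type*} [Fintype V] (E : Finset (Finset V)) (S : Finset V)
    (h : ∀ e ∈ E, ¬ e ⊆ S) : S.card ≤ indepNum E := by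
  unfold indepNum
  exact Finset.le_sup (f := Finset.card) (by simpa using h)

lemma tb_indep_le {V : Type*} [Fintype V] (E : Finset (Finset V)) (N : ℕ)
    (h : ∀ S : Finset V, (∀ e ∈ E, ¬ e ⊆ S) → S.card ≤ N) : indepNum E ≤ N := by
  unfold indepNum
  apply Finset.sup_le
  intro S hS
  exact h S (by simpa using hS)

lemma tb_upper (k α n : ℕ) (hk : 2 ≤ k)
    (h : ∃ E : Finset (Finset (Fin n)),
      IsUniformHyp k E ∧ indepNum E < α ∧ NoLoosePathTwo E) : n ≤ 2 * α - 2 := by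
  obtain ⟨E, hu, hi, hl⟩ := h
  obtain ⟨R, B, hU, hR, hB⟩ := tb_color E (fun e he => by rw [hu e he]; exact hk)
    (by intro e he f hf hne; convert hl e he f hf hne) Finset.univ
  have h1 := tb_le_indep E R hR
  have h2 := tb_le_indep E B hB
  have h3 := Finset.card_union_le R B
  rw [hU, Finset.card_univ, Fintype.card_fin] at h3
  omega

lemma tb_block (n M j : ℕ) (hM : 0 < M) :
    (Finset.univ.filter (fun v : Fin n => v.val / M = j)).card ≤ M := by
  have : ((Finset.univ.filter (fun v : Fin n => v.val / M = j)).image Fin.val)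
      ⊆ Finset.Ico (M * j) (M * j + M) := by
    intro x hx
    simp only [Finset.mem_image, Finset.mem_filter, Finset.mem_univ, true_and] at hx
    obtain ⟨v, hv, rfl⟩ := hx
    have h1 := Nat.div_add_mod v.val M
    have h2 := Nat.mod_lt v.val hM
    rw [hv] at h1
    simp only [Finset.mem_Ico]
    omega
  have h := Finset.card_le_card this
  rw [Finset.card_image_of_injective _ Fin.val_injective] at h
  simpa using h

lemma tb_lower (m q r : ℕ) (hm : 1 ≤ m) :
    ∃ E : Finset (Finset (Fin (2 * m * q + r))),
      IsUniformHyp (m + 1) E ∧ indepNum E < m * q + r + 1 ∧ NoLoosePathTwo E := by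
  obtain ⟨E, hE⟩ : ∃ E : Finset (Finset (Fin (2 * m * q + r))), ∀ e, e ∈ E ↔
      (e.card = m + 1 ∧ ∃ j < q, ∀ v ∈ e, v.val / (2 * m) = j) :=
    ⟨Finset.univ.filter (fun e => e.card = m + 1 ∧
      ∃ j < q, ∀ v ∈ e, v.val / (2 * m) = j), fun e => by simp⟩
  refine ⟨E, ?_, ?_, ?_⟩
  · intro e he
    exact ((hE e).mp he).1
  · rw [Nat.lt_succ_iff]
    apply tb_indep_le
    intro S hS
    have hb : ∀ j < q, (S.filter (fun v => v.val / (2 * m) = j)).card ≤ m := by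
      intro j hj
      by_contra hc
      obtain ⟨e, he, hec⟩ := Finset.exists_subset_card_eq (Nat.succ_le_of_lt (not_le.mp hc))
      refine hS e ?_ (he.trans (Finset.filter_subset _ _))
      rw [hE]
      exact ⟨hec, j, hj, fun v hv => (Finset.mem_filter.mp (he hv)).2⟩
    have h1 : (S.filter (fun v => v.val < 2 * m * q)).card ≤ m * q := by
      have := Finset.card_le_mul_card_image_of_maps_to
        (s := S.filter (fun v => v.val < 2 * m * q)) (t := Finset.range q)
        (f := fun v => v.val / (2 * m)) (by
          intro v hv
          have hv := (Finset.mem_filter.mp hv).2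
          simp only [Finset.mem_range]
          exact Nat.div_lt_of_lt_mul hv) m (by
          intro j hj
          refine le_trans (Finset.card_le_card ?_) (hb j (Finset.mem_range.mp hj))
          intro v hv
          simp only [Finset.mem_filter] at hv ⊢
          exact ⟨hv.1.1, hv.2⟩)
      simpa using this
    have h2 : (S.filter (fun v => ¬ v.val < 2 * m * q)).card ≤ r := by
      have : ((S.filter (fun v => ¬ v.val < 2 * m * q)).image Fin.val)
          ⊆ Finset.Ico (2 * m * q) (2 * m * q + r) := by
        intro x hx
        simp only [Finset.mem_image, Finset.mem_filter] at hx
        obtain ⟨v, hv, rfl⟩ := hx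
        have := v.isLt
        simp only [Finset.mem_Ico]
        exact ⟨not_lt.mp hv.2, this⟩
      have h := Finset.card_le_card this
      rw [Finset.card_image_of_injective _ Fin.val_injective] at h
      simpa using h
    have h3 := Finset.card_filter_add_card_filter_not (s := S) (fun v => v.val < 2 * m * q)
    omega
  · intro e he f hf hne hc
    obtain ⟨hec, j, hj, hej⟩ := (hE e).mp he
    obtain ⟨hfc, i, hi, hfi⟩ := (hE f).mp hf
    have hne' : (e ∩ f).Nonempty := by
      rw [← Finset.card_pos, hc]; exact one_pos
    obtain ⟨v, hv⟩ := hne'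
    rw [Finset.mem_inter] at hv
    have hij : j = i := (hej v hv.1).symm.trans (hfi v hv.2)
    subst hij
    have h1 : (e ∪ f).card ≤ 2 * m := by
      refine le_trans (Finset.card_le_card ?_) (tb_block _ (2 * m) j (by omega))
      intro x hx
      simp only [Finset.mem_filter, Finset.mem_univ, true_and]
      rcases Finset.mem_union.mp hx with h | h
      · exact hej x h
      · exact hfi x h
    have h2 := Finset.card_union_add_card_inter e f
    omega

/-- Bounds on `τ(k,α)`: for `α ≥ k ≥ 2`,
`α - 1 + (k-1)⌊(α-1)/(k-1)⌋ ≤ τ(k,α) ≤ 2α - 2`. -/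
theorem tau_bounds (k α : ℕ) (hk : 2 ≤ k) (hα : k ≤ α) :
    α - 1 + (k - 1) * ((α - 1) / (k - 1)) ≤ tauFn k α ∧ tauFn k α ≤ 2 * α - 2 := by
  have hmem : α - 1 + (k - 1) * ((α - 1) / (k - 1)) ∈ {n : ℕ | ∃ E : Finset (Finset (Fin n)),
      IsUniformHyp k E ∧ indepNum E < α ∧ NoLoosePathTwo E} := by
    have h := tb_lower (k - 1) ((α - 1) / (k - 1)) ((α - 1) % (k - 1)) (by omega)
    have hd := Nat.div_add_mod (α - 1) (k - 1)
    rw [show k - 1 + 1 = k by omega, hd, show α - 1 + 1 = α by omega,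
      show 2 * (k - 1) * ((α - 1) / (k - 1)) + (α - 1) % (k - 1)
        = α - 1 + (k - 1) * ((α - 1) / (k - 1)) by rw [mul_assoc]; omega] at h
    exact h
  have hub : ∀ n ∈ {n : ℕ | ∃ E : Finset (Finset (Fin n)),
      IsUniformHyp k E ∧ indepNum E < α ∧ NoLoosePathTwo E}, n ≤ 2 * α - 2 :=
    fun n hn => tb_upper k α n hk hn
  exact ⟨le_csSup ⟨_, hub⟩ hmem, csSup_le ⟨_, hmem⟩ hub⟩
end

section
/- Let k ≥ 3 be an integer and H be a k-graph. Then there exists an integer n_0 = n_0(H) such that, for all n ≥ n_0 satisfying n ≡ 1 (mod k-1), we have R(P_{n,1}^{(k)}, H) ≤ (χ(H)-1)(n-1) + max{ τ(k-1, σ(H)) - 2k + 3, σ(H) }. -/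
open scoped Classical

/-- A vertex colouring is proper if no edge is monochromatic. -/
def IsProperColoring {V : Type*} {r : ℕ} (E : Finset (Finset V)) (c : V → Fin r) : Prop :=
  ∀ e ∈ E, ∃ u ∈ e, ∃ v ∈ e, c u ≠ c v

/-- The chromatic number of a hypergraph. -/
noncomputable def chromNum {V : Type*} (E : Finset (Finset V)) : ℕ :=
  sInf {r : ℕ | ∃ c : V → Fin r, IsProperColoring E c}

/-- `σ(H)`: the smallest size of a colour class over all proper colourings of `H`
with `χ(H)` colours. -/
noncomputable def sigmaNum {V : Type*} [Fintype V] (E : Finset (Finset V)) : ℕ :=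
  sInf {s : ℕ | ∃ c : V → Fin (chromNum E), IsProperColoring E c ∧
    ∃ i, s = (Finset.univ.filter (fun v => c v = i)).card}
/-- Loose path with `q` edges. -/
inductive LP {V : Type*} [DecidableEq V] (d : ℕ) (red : Finset V → Prop) :
    V → V → Finset V → ℕ → Prop
  | nil (a : V) : LP d red a a {a} 0
  | cons {a b c : V} {e U : Finset V} {q : ℕ} : red e → e.card = d + 1 → a ∈ e → b ∈ e → a ≠ b →
      e ∩ U = {b} → LP d red b c U q → LP d red a c (e ∪ U) (q + 1)

section LPsec
variable {V : Type*} [DecidableEq V] {d : ℕ} {red : Finset V → Prop}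

theorem LP.start_mem {a b : V} {U : Finset V} {q : ℕ} (h : LP d red a b U q) : a ∈ U := by
  cases h with
  | nil => simp
  | cons h1 h2 h3 h4 h5 h6 h7 => simp [h3]

theorem LP.end_mem {a b : V} {U : Finset V} {q : ℕ} (h : LP d red a b U q) : b ∈ U := by
  induction h with
  | nil => simp
  | cons h1 h2 h3 h4 h5 h6 h7 ih => simp [ih]

theorem LP.card_eq {a b : V} {U : Finset V} {q : ℕ} (h : LP d red a b U q) :
    U.card = q * d + 1 := by
  induction h with
  | nil => simp
  | cons h1 h2 h3 h4 h5 h6 h7 ih =>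
    rename_i e U q
    have h9 := Finset.card_union_add_card_inter e U
    rw [h6, Finset.card_singleton] at h9
    rw [add_mul]; omega

theorem LP.cons' {a b c : V} {e U W : Finset V} {q : ℕ} (h1 : red e) (h2 : e.card = d + 1)
    (h3 : a ∈ e) (h4 : b ∈ e) (h5 : a ≠ b) (h6 : ∀ x ∈ e, x ∈ U → x = b)
    (h7 : LP d red b c U q) (h8 : W = e ∪ U) : LP d red a c W (q + 1) := by
  subst h8
  refine LP.cons h1 h2 h3 h4 h5 ?_ h7
  have := h7.start_mem
  ext x
  simp only [Finset.mem_inter, Finset.mem_singleton]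
  constructor
  · rintro ⟨hx, hy⟩; exact h6 x hx hy
  · rintro rfl; exact ⟨h4, this⟩

theorem LP.snoc {a b c : V} {e U : Finset V} {q : ℕ} (h : LP d red a b U q) (h1 : red e)
    (h2 : e.card = d + 1) (h3 : b ∈ e) (h4 : c ∈ e) (h5 : b ≠ c) (h6 : ∀ x ∈ e, x ∈ U → x = b) :
    LP d red a c (U ∪ e) (q + 1) := by
  induction h with
  | nil a =>
    refine LP.cons' h1 h2 h3 h4 h5 ?_ (LP.nil c) ?_
    · intro x _ hx; simpa using hx
    · ext x; simp only [Finset.mem_union, Finset.mem_singleton]; grind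
  | cons g1 g2 g3 g4 g5 g6 g7 ih =>
    have h8 := ih h3 h5 (fun x hx hy => h6 x hx (Finset.mem_union_right _ hy))
    have h9 := g7.end_mem
    refine LP.cons' g1 g2 g3 g4 g5 ?_ h8 (by rw [Finset.union_assoc])
    intro x hx hy
    rename_i U' q' 
    have : x ∈ U' := by
      rcases Finset.mem_union.1 hy with hy | hy
      · exact hy
      · have := h6 x hy (Finset.mem_union_left _ hx)
        rw [this]; exact h9
    have : x ∈ _ ∩ U' := Finset.mem_inter.2 ⟨hx, this⟩
    rw [g6] at this
    simpa using this

theorem LP.rev {a b : V} {U : Finset V} {q : ℕ} (h : LP d red a b U q) : LP d red b a U q := by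
  induction h with
  | nil a => exact LP.nil a
  | cons g1 g2 g3 g4 g5 g6 g7 ih =>
    rw [Finset.union_comm]
    refine ih.snoc g1 g2 g4 g3 g5.symm ?_
    intro x hx hy
    have := Finset.mem_inter.2 ⟨hx, hy⟩
    rw [g6] at this
    simpa using this

theorem LP.concat {a b c : V} {U W X : Finset V} {p q : ℕ} (h : LP d red a b U p)
    (h' : LP d red b c W q) (h6 : ∀ x ∈ U, x ∈ W → x = b) (hX : X = U ∪ W) :
    LP d red a c X (p + q) := by
  induction h generalizing X with
  | nil a =>
    have := h'.start_mem
    have h8 : X = W := by subst hX; ext x; simp only [Finset.mem_union, Finset.mem_singleton]; grind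
    subst h8; simpa using h'
  | cons g1 g2 g3 g4 g5 g6 g7 ih =>
    have h8 := ih h' (fun x hx hy => h6 x (Finset.mem_union_right _ hx) hy) rfl
    have h9 := g7.end_mem
    rename_i U' q'
    have h10 : q' + 1 + q = q' + q + 1 := by ring
    rw [h10]
    refine LP.cons' g1 g2 g3 g4 g5 ?_ h8 (by rw [hX, Finset.union_assoc])
    intro x hx hy
    have : x ∈ U' := by
      rcases Finset.mem_union.1 hy with hy | hy
      · exact hy
      · have := h6 x (Finset.mem_union_left _ hx) hy
        rw [this]; exact h9
    have : x ∈ _ ∩ U' := Finset.mem_inter.2 ⟨hx, this⟩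
    rw [g6] at this
    simpa using this

theorem LP.pref {a b : V} {U : Finset V} {q : ℕ} (h : LP d red a b U q) :
    ∀ q' ≤ q, ∃ b' U', U' ⊆ U ∧ LP d red a b' U' q' := by
  induction h with
  | nil a =>
    intro q' hq'
    obtain rfl : q' = 0 := by omega
    exact ⟨a, {a}, le_refl _, LP.nil a⟩
  | cons g1 g2 g3 g4 g5 g6 g7 ih =>
    intro q' hq'
    rename_i a b c e U q
    rcases q' with _ | q'
    · exact ⟨a, {a}, by simp [g3], LP.nil a⟩
    · obtain ⟨b', U', hU', h'⟩ := ih q' (by omega)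
      refine ⟨b', e ∪ U', Finset.union_subset_union_right hU', LP.cons' g1 g2 g3 g4 g5 ?_ h' rfl⟩
      intro x hx hy
      have := Finset.mem_inter.2 ⟨hx, hU' hy⟩
      rw [g6] at this
      simpa using this

theorem enum_edge {e : Finset V} {a b : V} (hd : 1 ≤ d) (he : e.card = d + 1) (ha : a ∈ e)
    (hb : b ∈ e) (hab : a ≠ b) : ∃ h : ℕ → V, h 0 = a ∧ h d = b ∧
      (∀ i ≤ d, ∀ j ≤ d, h i = h j → i = j) ∧ (Finset.range (d + 1)).image h = e := by
  have f0 : Fin (d + 1) ≃ e := (Finset.equivFinOfCardEq he).symm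
  let f1 : Fin (d + 1) ≃ e := (Equiv.swap 0 (f0.symm ⟨a, ha⟩)).trans f0
  have h1 : f1 0 = ⟨a, ha⟩ := by simp [f1]
  let f2 : Fin (d + 1) ≃ e := (Equiv.swap (Fin.last d) (f1.symm ⟨b, hb⟩)).trans f1
  have h2 : f2 (Fin.last d) = ⟨b, hb⟩ := by simp [f2]
  have h3 : f2 0 = ⟨a, ha⟩ := by
    have : Equiv.swap (Fin.last d) (f1.symm ⟨b, hb⟩) 0 = 0 := by
      apply Equiv.swap_apply_of_ne_of_ne
      · intro h; have := congrArg Fin.val h; simp at this; omega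
      · intro h
        have := congrArg f1 h
        rw [h1] at this
        simp at this; exact hab this
    simp only [f2, Equiv.trans_apply, this, h1]
  refine ⟨fun i => if h : i < d + 1 then (f2 ⟨i, h⟩ : V) else a, ?_, ?_, ?_, ?_⟩
  · simp only [Nat.zero_lt_succ, dite_true]
    exact congrArg Subtype.val h3
  · simp only [Nat.lt_succ_self, dite_true]
    exact congrArg Subtype.val h2
  · intro i hi j hj hij
    simp only [show i < d + 1 by omega, show j < d + 1 by omega, dite_true] at hij
    have := f2.injective (Subtype.ext hij)
    simpa using this
  · ext x
    simp only [Finset.mem_image, Finset.mem_range]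
    constructor
    · rintro ⟨i, hi, rfl⟩
      simp only [hi, dite_true]; exact (f2 _).2
    · intro hx
      refine ⟨(f2.symm ⟨x, hx⟩ : Fin (d + 1)), (f2.symm ⟨x, hx⟩).2, ?_⟩
      simp only [(f2.symm ⟨x, hx⟩).2, dite_true]
      simp

theorem LP.toFun (hd : 1 ≤ d) {a b : V} {U : Finset V} {q : ℕ} (h : LP d red a b U q) :
    ∃ g : ℕ → V, g 0 = a ∧ (∀ i ≤ q * d, ∀ j ≤ q * d, g i = g j → i = j) ∧
      (∀ i ≤ q * d, g i ∈ U) ∧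
      ∀ i < q, red ((Finset.range (d + 1)).image (fun j => g (i * d + j))) := by
  induction h with
  | nil a => exact ⟨fun _ => a, rfl, by intros; omega, by simp, by simp⟩
  | cons g1 g2 g3 g4 g5 g6 g7 ih =>
    rename_i a b c e U q
    obtain ⟨g, hg0, hginj, hgU, hgred⟩ := ih
    obtain ⟨h, h0, hd', hinj, him⟩ := enum_edge hd g2 g3 g4 g5
    have hE : ∀ i ≤ d, h i ∈ e := by
      intro i hi; rw [← him]; exact Finset.mem_image_of_mem _ (Finset.mem_range.2 (by omega))
    have key : ∀ i ≤ d, ∀ j, j ≤ q * d → h i = g j → i = d ∧ j = 0 := by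
      intro i hi j hj hij
      have h1 : h i ∈ e ∩ U := Finset.mem_inter.2 ⟨hE i hi, hij ▸ hgU j hj⟩
      rw [g6, Finset.mem_singleton] at h1
      refine ⟨hinj i hi d le_rfl (h1.trans hd'.symm), hginj j hj 0 (by omega) ?_⟩
      rw [← hij, h1, hg0]
    refine ⟨fun j => if j ≤ d then h j else g (j - d), by simp [h0], ?_, ?_, ?_⟩
    · intro i hi j hj hij
      rw [add_mul] at hi hj
      dsimp only at hij
      split_ifs at hij with h1 h2 h2
      · exact hinj i h1 j h2 hij
      · have := key i h1 (j - d) (by omega) hij; omega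
      · have := key j h2 (i - d) (by omega) hij.symm; omega
      · have := hginj (i - d) (by omega) (j - d) (by omega) hij; omega
    · intro i hi
      rw [add_mul] at hi
      dsimp only
      split_ifs with h1
      · exact Finset.mem_union_left _ (hE i h1)
      · exact Finset.mem_union_right _ (hgU _ (by omega))
    · intro i hi
      rcases i with _ | i
      · convert g1 using 1
        rw [← him]
        apply Finset.image_congr
        intro j hj
        have : j ≤ d := by simpa [Nat.lt_succ_iff] using hj
        simp [this]
      · convert hgred i (by omega) using 1
        apply Finset.image_congr
        intro j hj
        dsimp only
        split_ifs with h1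
        · rw [add_mul] at h1
          have h2 : i * d = 0 := by omega
          have h3 : j = 0 := by omega
          rw [add_mul, h2, h3]; simp [hd', hg0]
        · congr 1; rw [add_mul]; omega
end LPsec

theorem LP.monoCopy {V : Type*} [DecidableEq V] {d : ℕ} (hd : 1 ≤ d) {c : Finset V → Bool} {a b : V}
    {U : Finset V} {q Q n : ℕ} (h : LP d (fun e => c e = true) a b U q) (hQ : Q ≤ q)
    (hn : n = Q * d + 1) : hasMonoCopy c true (ellPathEdges (d + 1) 1 n) := by
  obtain ⟨b', U', -, h'⟩ := h.pref Q hQ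
  obtain ⟨g, -, hinj, -, hred⟩ := h'.toFun hd
  refine ⟨fun v => g v, ?_, ?_⟩
  · intro x y hxy
    have hx := x.2; have hy := y.2
    exact Fin.ext (hinj x (by omega) y (by omega) hxy)
  · intro e he
    simp only [ellPathEdges, Finset.mem_image, Finset.mem_range] at he
    obtain ⟨i, hi, rfl⟩ := he
    have hi' : i < Q := by
      rw [hn] at hi
      simpa [Nat.mul_div_cancel _ (show 0 < d by omega)] using hi
    convert hred i hi' using 2
    ext x
    simp only [Finset.mem_image, Finset.mem_filter, Finset.mem_univ, true_and, Finset.mem_range,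
      Nat.add_sub_cancel]
    constructor
    · rintro ⟨v, ⟨h1, h2⟩, rfl⟩
      exact ⟨v - i * d, by omega, by congr 1; omega⟩
    · rintro ⟨j, hj, rfl⟩
      have : (i + 1) * d ≤ Q * d := Nat.mul_le_mul_right _ hi'
      rw [add_mul] at this
      exact ⟨⟨i * d + j, by omega⟩, ⟨by simp, by simp; omega⟩, rfl⟩

theorem card_le_indepNum {V : Type*} [Fintype V] {E : Finset (Finset V)} {S : Finset V}
    (hS : ∀ e ∈ E, ¬ e ⊆ S) : S.card ≤ indepNum E := by
  unfold indepNum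
  exact Finset.le_sup (f := Finset.card) (Finset.mem_filter.2 ⟨Finset.mem_univ _, hS⟩)

theorem indepNum_lt {V : Type*} [Fintype V] {E : Finset (Finset V)} {σ : ℕ} (h : 0 < σ)
    (hS : ∀ S : Finset V, (∀ e ∈ E, ¬ e ⊆ S) → S.card < σ) : indepNum E < σ := by
  unfold indepNum
  rw [Finset.sup_lt_iff (by simpa using h)]
  intro S hS'
  exact hS S (Finset.mem_filter.1 hS').2


theorem ramsey_hyp (k : ℕ) : ∀ p q : ℕ, ∃ D : ℕ, ∀ {V : Type} [DecidableEq V] (c : Finset V → Bool)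
    (X : Finset V), D ≤ X.card →
      (∃ Y ⊆ X, Y.card = p ∧ ∀ e ⊆ Y, e.card = k → c e = true) ∨
      (∃ Y ⊆ X, Y.card = q ∧ ∀ e ⊆ Y, e.card = k → c e = false) := by
  induction k with
  | zero =>
    intro p q
    refine ⟨max p q, ?_⟩
    intro V _ c X hX
    rcases h : c ∅ with _ | _
    · right
      obtain ⟨Y, hY, hc⟩ := Finset.exists_subset_card_eq (le_trans (le_max_right p q) hX)
      exact ⟨Y, hY, hc, fun e _ he => by rw [Finset.card_eq_zero.1 he, h]⟩
    · left
      obtain ⟨Y, hY, hc⟩ := Finset.exists_subset_card_eq (le_trans (le_max_left p q) hX)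
      exact ⟨Y, hY, hc, fun e _ he => by rw [Finset.card_eq_zero.1 he, h]⟩
  | succ k ihk =>
    have triv : ∀ {V : Type} [DecidableEq V] (c : Finset V → Bool) (b : Bool),
        ∀ e ⊆ (∅ : Finset V), e.card = k + 1 → c e = b := by
      intro V _ c b e he hc
      rw [Finset.subset_empty.1 he] at hc; simp at hc
    have ext : ∀ {V : Type} [DecidableEq V] (c : Finset V → Bool) (b : Bool) (v : V)
        (Y Z : Finset V), Z ⊆ Y → (∀ e ⊆ Y, e.card = k → c (insert v e) = b) → 
        (∀ e ⊆ Z, e.card = k + 1 → c e = b) → ∀ e ⊆ insert v Z, e.card = k + 1 → c e = b := by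
      intro V _ c b v Y Z hZ h1 h2 e he hc
      by_cases hv : v ∈ e
      · rw [← Finset.insert_erase hv]
        apply h1
        · refine subset_trans ?_ hZ
          intro x hx
          rw [Finset.mem_erase] at hx
          have := he hx.2
          rw [Finset.mem_insert] at this
          tauto
        · rw [Finset.card_erase_of_mem hv]; omega
      · apply h2 e _ hc
        intro x hx
        have := he hx
        rw [Finset.mem_insert] at this
        rcases this with rfl | h
        · exact absurd hx hv
        · exact h
    intro p
    induction p with
    | zero =>
      intro q
      exact ⟨0, fun c X _ => Or.inl ⟨∅, by simp, by simp, triv c true⟩⟩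
    | succ p ihp =>
      intro q
      induction q with
      | zero => exact ⟨0, fun c X _ => Or.inr ⟨∅, by simp, by simp, triv c false⟩⟩
      | succ q ihq =>
        obtain ⟨D1, h1⟩ := ihp (q + 1)
        obtain ⟨D2, h2⟩ := ihq
        obtain ⟨D, hD⟩ := ihk D1 D2
        refine ⟨D + 1, ?_⟩
        intro V _ c X hX
        obtain ⟨v, hv⟩ : X.Nonempty := Finset.card_pos.1 (by omega)
        have hX' : D ≤ (X.erase v).card := by rw [Finset.card_erase_of_mem hv]; omega
        rcases hD (fun e => c (insert v e)) (X.erase v) hX' with ⟨Y, hY, hYc, hYe⟩ | ⟨Y, hY, hYc, hYe⟩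
        · have hvY : v ∉ Y := fun h => by simpa using hY h
          have hYX : Y ⊆ X := hY.trans (Finset.erase_subset _ _)
          rcases h1 c Y hYc.ge with ⟨Z, hZ, hZc, hZe⟩ | ⟨Z, hZ, hZc, hZe⟩
          · left
            refine ⟨insert v Z, ?_, ?_, ext c true v Y Z hZ hYe hZe⟩
            · exact Finset.insert_subset hv (hZ.trans hYX)
            · rw [Finset.card_insert_of_notMem (fun h => hvY (hZ h)), hZc]
          · exact Or.inr ⟨Z, hZ.trans hYX, hZc, hZe⟩
        · have hvY : v ∉ Y := fun h => by simpa using hY h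
          have hYX : Y ⊆ X := hY.trans (Finset.erase_subset _ _)
          rcases h2 c Y hYc.ge with ⟨Z, hZ, hZc, hZe⟩ | ⟨Z, hZ, hZc, hZe⟩
          · exact Or.inl ⟨Z, hZ.trans hYX, hZc, hZe⟩
          · right
            refine ⟨insert v Z, ?_, ?_, ext c false v Y Z hZ hYe hZe⟩
            · exact Finset.insert_subset hv (hZ.trans hYX)
            · rw [Finset.card_insert_of_notMem (fun h => hvY (hZ h)), hZc]

theorem tau_bdd (d α : ℕ) (hd : 2 ≤ d) : BddAbove {n : ℕ | ∃ E : Finset (Finset (Fin n)),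
    IsUniformHyp d E ∧ indepNum E < α ∧ NoLoosePathTwo E} := by
  refine ⟨α + α * 2 ^ α, ?_⟩
  rintro n ⟨E, hu, hi, hp⟩
  have hind : ∀ S : Finset (Fin n), (∀ e ∈ E, ¬ e ⊆ S) → S.card < α := by
    intro S hS
    exact lt_of_le_of_lt (card_le_indepNum hS) hi
  have hne : (Finset.univ.filter (fun S : Finset (Fin n) => ∀ e ∈ E, ¬ e ⊆ S)).Nonempty := by
    refine ⟨∅, Finset.mem_filter.2 ⟨Finset.mem_univ _, ?_⟩⟩
    intro e he h
    have := hu e he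
    rw [Finset.subset_empty.1 h] at this; simp at this; omega
  obtain ⟨S, hS, hmax⟩ := Finset.exists_max_image _ Finset.card hne
  rw [Finset.mem_filter] at hS
  have hS := hS.2
  have h1 : ∀ v, ∃ e, v ∉ S → e ∈ E ∧ e ⊆ insert v S ∧ v ∈ e := by
    intro v
    by_cases hv : v ∈ S
    · exact ⟨∅, fun h => absurd hv h⟩
    · by_contra hcon
      push Not at hcon
      have := hmax (insert v S) (Finset.mem_filter.2 ⟨Finset.mem_univ _, ?_⟩)
      · rw [Finset.card_insert_of_notMem hv] at this; omega
      · intro e he hes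
        have h2 := (hcon e).2 he hes
        apply hS e he
        intro x hx
        rcases Finset.mem_insert.1 (hes hx) with rfl | h
        · exact absurd hx h2
        · exact h
  choose g hg using h1
  have hfib : ∀ T ∈ (Sᶜ).image (fun v => (g v).erase v),
      ((Sᶜ).filter (fun v => (g v).erase v = T)).card ≤ α := by
    intro T hT
    by_contra hcon
    push Not at hcon
    have h2 : ¬ ∀ e ∈ E, ¬ e ⊆ ((Sᶜ).filter (fun v => (g v).erase v = T)) := by
      intro h; have := hind _ h; omega
    push Not at h2
    obtain ⟨f, hf, hfs⟩ := h2
    have hfc := hu f hf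
    obtain ⟨v, hv⟩ : f.Nonempty := Finset.card_pos.1 (by omega)
    have hv1 := Finset.mem_filter.1 (hfs hv)
    have hvS : v ∉ S := by simpa using hv1.1
    obtain ⟨hgE, hgs, hgv⟩ := hg v hvS
    have hgc := hu _ hgE
    have hsub : ∀ x ∈ g v, x ∉ S → x = v := by
      intro x hx hxS
      rcases Finset.mem_insert.1 (hgs hx) with h | h
      · exact h
      · exact absurd h hxS
    have hfS : ∀ x ∈ f, x ∉ S := by
      intro x hx
      have := (Finset.mem_filter.1 (hfs hx)).1
      simpa using this
    have hint : f ∩ g v = {v} := by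
      ext x
      simp only [Finset.mem_inter, Finset.mem_singleton]
      constructor
      · rintro ⟨h3, h4⟩; exact hsub x h4 (hfS x h3)
      · rintro rfl; exact ⟨hv, hgv⟩
    refine hp f hf (g v) hgE ?_ (by rw [hint]; simp)
    intro h
    rw [← h, Finset.inter_self] at hint
    rw [hint] at hfc; simp at hfc; omega
  have h3 := Finset.card_le_mul_card_image (Sᶜ) α hfib
  have h4 : ((Sᶜ).image (fun v => (g v).erase v)).card ≤ 2 ^ S.card := by
    rw [← Finset.card_powerset]
    apply Finset.card_le_card
    intro T hT
    obtain ⟨v, hv, rfl⟩ := Finset.mem_image.1 hT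
    have hvS : v ∉ S := by simpa using hv
    obtain ⟨hgE, hgs, hgv⟩ := hg v hvS
    rw [Finset.mem_powerset]
    intro x hx
    rw [Finset.mem_erase] at hx
    rcases Finset.mem_insert.1 (hgs hx.2) with h | h
    · exact absurd h hx.1
    · exact h
  have h5 := hind S hS
  have h6 : 2 ^ S.card ≤ 2 ^ α := Nat.pow_le_pow_right (by norm_num) h5.le
  have h7 := Finset.card_add_card_compl S
  rw [Fintype.card_fin] at h7
  have h8 : α * ((Sᶜ).image (fun v => (g v).erase v)).card ≤ α * 2 ^ α :=
    Nat.mul_le_mul_left _ (h4.trans h6)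
  omega

theorem tau_use {V : Type} [DecidableEq V] {d σ : ℕ} (hd : 2 ≤ d) (F : Finset (Finset V))
    (B : Finset V) (hB : tauFn d σ < B.card) (hFc : ∀ f ∈ F, f.card = d) (hFB : ∀ f ∈ F, f ⊆ B)
    (hF2 : ∀ f ∈ F, ∀ f' ∈ F, (f ∩ f').card ≠ 1) :
    ∃ W ⊆ B, W.card = σ ∧ ∀ f ∈ F, ¬ f ⊆ W := by
  have h0 : B.card ∉ {n : ℕ | ∃ E : Finset (Finset (Fin n)),
    IsUniformHyp d E ∧ indepNum E < σ ∧ NoLoosePathTwo E} := by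
    intro h
    have := le_csSup (tau_bdd d σ hd) h
    exact absurd hB (not_lt.2 this)
  let em : Fin B.card ↪ V := (B.equivFin.symm.toEmbedding).trans (Function.Embedding.subtype _)
  let E : Finset (Finset (Fin B.card)) := Finset.univ.filter (fun s => s.map em ∈ F)
  have hE : ∀ s, s ∈ E ↔ s.map em ∈ F := by intro s; simp [E]
  have hem : ∀ x ∈ B, ∃ i, em i = x := by
    intro x hx
    exact ⟨B.equivFin ⟨x, hx⟩, by simp [em]⟩
  have hem' : ∀ i, em i ∈ B := fun i => (B.equivFin.symm i).2
  have h1 : ¬ indepNum E < σ := by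
    intro h
    apply h0
    refine ⟨E, ?_, h, ?_⟩
    · intro s hs
      rw [hE] at hs
      simpa using hFc _ hs
    · intro s hs t ht _ hc
      rw [hE] at hs ht
      apply hF2 _ hs _ ht
      rw [← Finset.map_inter, Finset.card_map, hc]
  obtain ⟨S, hS, hSc⟩ : ∃ S : Finset (Fin B.card), (∀ e ∈ E, ¬ e ⊆ S) ∧ σ ≤ S.card := by
    by_contra hcon
    push Not at hcon
    rcases Nat.eq_zero_or_pos σ with h | h
    · have := hcon ∅ ?_
      · omega
      · intro e he h2
        have h3 := hFc _ ((hE e).1 he)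
        rw [Finset.subset_empty.1 h2] at h3
        simp at h3; omega
    · apply h1
      exact indepNum_lt h hcon
  obtain ⟨S', hS', hSc'⟩ := Finset.exists_subset_card_eq hSc
  refine ⟨S'.map em, ?_, by simpa using hSc', ?_⟩
  · intro x hx
    obtain ⟨i, _, rfl⟩ := Finset.mem_map.1 hx
    exact hem' i
  · intro f hf hfS
    have h2 : (S'.filter (fun i => em i ∈ f)).map em = f := by
      ext x
      simp only [Finset.mem_map, Finset.mem_filter]
      constructor
      · rintro ⟨i, ⟨_, h⟩, rfl⟩; exact h
      · intro hx
        obtain ⟨i, hi, rfl⟩ := Finset.mem_map.1 (hfS hx)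
        exact ⟨i, ⟨hi, hx⟩, rfl⟩
    apply hS (S'.filter (fun i => em i ∈ f))
    · rw [hE, h2]; exact hf
    · exact (Finset.filter_subset _ _).trans hS'

theorem chrom_att {k nH : ℕ} (hk : 2 ≤ k) (H : Finset (Finset (Fin nH))) (hHu : IsUniformHyp k H) :
    ∃ c : Fin nH → Fin (chromNum H), IsProperColoring H c := by
  have : (chromNum H) ∈ {r : ℕ | ∃ c : Fin nH → Fin r, IsProperColoring H c} := by
    apply Nat.sInf_mem
    refine ⟨nH, id, ?_⟩
    intro e he
    obtain ⟨u, hu, v, hv, huv⟩ := Finset.one_lt_card.1 (show 1 < e.card by rw [hHu e he]; omega)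
    exact ⟨u, hu, v, hv, huv⟩
  exact this

theorem sigma_att {k nH : ℕ} (hk : 2 ≤ k) (H : Finset (Finset (Fin nH))) (hHu : IsUniformHyp k H)
    (hc : 1 ≤ chromNum H) : ∃ c : Fin nH → Fin (chromNum H), IsProperColoring H c ∧
      ∃ i, sigmaNum H = (Finset.univ.filter (fun v => c v = i)).card := by
  have : sigmaNum H ∈ {s : ℕ | ∃ c : Fin nH → Fin (chromNum H), IsProperColoring H c ∧
      ∃ i, s = (Finset.univ.filter (fun v => c v = i)).card} := by
    apply Nat.sInf_mem
    obtain ⟨c, h⟩ := chrom_att hk H hHu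
    exact ⟨_, c, h, ⟨0, hc⟩, rfl⟩
  exact this

theorem sigma_le {k nH : ℕ} (hk : 2 ≤ k) (H : Finset (Finset (Fin nH))) (hHu : IsUniformHyp k H)
    (hc : 1 ≤ chromNum H) : sigmaNum H ≤ nH := by
  obtain ⟨c, -, i, h⟩ := sigma_att hk H hHu hc
  rw [h]
  exact (Finset.card_le_univ _).trans (by simp)

theorem embedH {k nH : ℕ} (hk : 2 ≤ k) (H : Finset (Finset (Fin nH))) (hHu : IsUniformHyp k H)
    {V : Type} [DecidableEq V] (c : Finset V → Bool) {r : ℕ} (hr : chromNum H = r)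
    (Vs : Fin r → Finset V) (i0 : Fin r) (hdis : ∀ i j, i ≠ j → Disjoint (Vs i) (Vs j))
    (h1 : ∀ i, i ≠ i0 → nH ≤ (Vs i).card) (h2 : sigmaNum H ≤ (Vs i0).card)
    (h3 : ∀ e : Finset V, e.card = k → (∀ x ∈ e, ∃ i, x ∈ Vs i) → (∀ i, ¬ e ⊆ Vs i) →
      c e = false) : hasMonoCopy c false H := by
  subst hr
  obtain ⟨φ, hφ, i1, hσ⟩ := sigma_att hk H hHu (by have := i0.2; omega)
  let Ws : Fin (chromNum H) → Finset V := fun i => Vs (Equiv.swap i0 i1 i)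
  have hdisW : ∀ i j, i ≠ j → Disjoint (Ws i) (Ws j) := fun i j hij =>
    hdis _ _ (fun h => hij ((Equiv.swap i0 i1).injective h))
  have hcard : ∀ i, Fintype.card {v // φ v = i} ≤ Fintype.card (Ws i) := by
    intro i
    rw [Fintype.card_coe, Fintype.card_subtype]
    by_cases hi : i = i1
    · subst hi
      simp only [Ws, Equiv.swap_apply_right]
      rw [← hσ]; exact h2
    · refine le_trans ?_ (h1 _ ?_)
      · exact (Finset.card_le_univ _).trans (by simp)
      · intro h
        apply hi
        have := congrArg (Equiv.swap i0 i1) h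
        simpa using this
  have hemb : ∀ i, Nonempty ({v // φ v = i} ↪ Ws i) := fun i =>
    Function.Embedding.nonempty_of_card_le (hcard i)
  have em := fun i => (hemb i).some
  have key : ∀ i j (u : {v // φ v = i}) (v : {v // φ v = j}), (em i u : V) = em j v →
      u.1 = v.1 := by
    intro i j u v h
    by_cases hij : i = j
    · subst hij
      rw [(em i).injective (Subtype.ext h)]
    · exfalso
      have := Finset.disjoint_left.1 (hdisW i j hij) (em i u).2
      rw [h] at this
      exact this (em j v).2
  have hinj : Function.Injective (fun v => (em (φ v) ⟨v, rfl⟩ : V)) := by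
    intro u v h
    exact key _ _ _ _ h
  have hmem : ∀ v, (em (φ v) ⟨v, rfl⟩ : V) ∈ Ws (φ v) := fun v => (em (φ v) ⟨v, rfl⟩).2
  refine ⟨_, hinj, ?_⟩
  intro e he
  apply h3
  · rw [Finset.card_image_of_injective _ hinj, hHu e he]
  · intro x hx
    obtain ⟨v, _, rfl⟩ := Finset.mem_image.1 hx
    exact ⟨_, hmem v⟩
  · intro i hi
    obtain ⟨u, hu, v, hv, huv⟩ := hφ e he
    have h4 := hi (Finset.mem_image_of_mem _ hu)
    have h5 := hi (Finset.mem_image_of_mem _ hv)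
    have h6 : ∀ w, (em (φ w) ⟨w, rfl⟩ : V) ∈ Vs i → Equiv.swap i0 i1 (φ w) = i := by
      intro w hw
      by_contra h
      exact Finset.disjoint_left.1 (hdis _ _ h) (hmem w) hw
    apply huv
    apply (Equiv.swap i0 i1).injective
    rw [h6 u h4, h6 v h5]


theorem embedN {k nH : ℕ} (hk : 2 ≤ k) (H : Finset (Finset (Fin nH))) (hHu : IsUniformHyp k H)
    {V : Type} [DecidableEq V] (c : Finset V → Bool) {ρ : ℕ} (hr : chromNum H = ρ + 1)
    (hno : ¬ hasMonoCopy c false H)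
    (C : ℕ → Finset V) (hdis : ∀ i j, i < j → j ≤ ρ → Disjoint (C i) (C j))
    (h1 : ∀ i, i < ρ → nH ≤ (C i).card) (h2 : sigmaNum H ≤ (C ρ).card) :
    ∃ e : Finset V, c e = true ∧ e.card = k ∧ (∀ x ∈ e, ∃ i ≤ ρ, x ∈ C i) ∧
      ∀ i ≤ ρ, ¬ e ⊆ C i := by
  by_contra hcon
  push Not at hcon
  apply hno
  refine embedH hk H hHu c hr (fun i => C i) (Fin.last ρ) ?_ ?_ (by simpa using h2) ?_
  · intro i j hij
    rcases lt_or_gt_of_ne (fun h => hij (Fin.ext h) : (i : ℕ) ≠ j) with h | h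
    · exact hdis _ _ h (by omega)
    · exact (hdis _ _ h (by omega)).symm
  · intro i hi
    apply h1
    have : (i : ℕ) ≠ ρ := fun h => hi (Fin.ext h)
    omega
  · intro e he h3 h4
    by_contra h5
    obtain ⟨i, hi, hi2⟩ := hcon e (by simpa using h5) he
      (fun x hx => by obtain ⟨i, hi⟩ := h3 x hx; exact ⟨i, by omega, hi⟩)
    exact h4 ⟨i, by omega⟩ hi2

section Cliq
variable {V : Type} [DecidableEq V] {d : ℕ} {red : Finset V → Prop}

theorem disj_out {s t : Finset V} (h : Disjoint s t) : ∀ y, y ∈ s → y ∉ t :=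
  fun _ hy => Finset.disjoint_left.1 h hy

/-- red clique -/
def Clq (d : ℕ) (red : Finset V → Prop) (A : Finset V) : Prop := ∀ e ⊆ A, e.card = d + 1 → red e

theorem Clq.mono {A B : Finset V} (h : Clq d red A) (hB : B ⊆ A) : Clq d red B :=
  fun e he hc => h e (he.trans hB) hc

theorem extend {A R Z : Finset V} {a b x : V} {q : ℕ} (hd : 1 ≤ d) (hA : Clq d red A) (ha : a ∈ A)
    (h : LP d red a b R q) (hx : x ∈ A) (hxR : x ∉ R) (hc : d ≤ ((A \ R) \ Z).card) :
    ∃ g ⊆ A, x ∈ g ∧ a ∈ g ∧ g.card = d + 1 ∧ (∀ y ∈ g, y ∈ R → y = a) ∧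
      (∀ y ∈ g, y ∈ Z → y = x ∨ y = a) ∧ LP d red x b (g ∪ R) (q + 1) := by
  have haR := h.start_mem
  obtain ⟨S, hS, hSc⟩ := Finset.exists_subset_card_eq
    (show d - 1 ≤ (((A \ R) \ Z).erase x).card from
      (by omega : d - 1 ≤ ((A \ R) \ Z).card - 1).trans Finset.pred_card_le_card_erase)
  have hS' : ∀ y ∈ S, y ∈ A ∧ y ∉ R ∧ y ∉ Z ∧ y ≠ x := by
    intro y hy
    have := hS hy
    simp only [Finset.mem_erase, Finset.mem_sdiff] at this
    tauto
  have hxa : x ≠ a := fun h => hxR (h ▸ haR)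
  have hg : insert x (insert a S) ⊆ A := by
    intro y hy
    simp only [Finset.mem_insert] at hy
    rcases hy with rfl | rfl | hy
    · exact hx
    · exact ha
    · exact (hS' y hy).1
  have hgc : (insert x (insert a S)).card = d + 1 := by
    rw [Finset.card_insert_of_notMem, Finset.card_insert_of_notMem]
    · omega
    · intro h; exact (hS' a h).2.1 haR
    · simp only [Finset.mem_insert, not_or]
      exact ⟨hxa, fun h => (hS' x h).2.2.2 rfl⟩
  have hgR : ∀ y ∈ insert x (insert a S), y ∈ R → y = a := by
    intro y hy hyR
    simp only [Finset.mem_insert] at hy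
    rcases hy with rfl | rfl | hy
    · exact absurd hyR hxR
    · rfl
    · exact absurd hyR (hS' y hy).2.1
  refine ⟨insert x (insert a S), hg, by simp, by simp, hgc, hgR, ?_, ?_⟩
  · intro y hy hyZ
    simp only [Finset.mem_insert] at hy
    rcases hy with rfl | rfl | hy
    · left; rfl
    · right; rfl
    · exact absurd hyZ (hS' y hy).2.2.1
  · exact LP.cons' (hA _ hg hgc) hgc (by simp) (by simp) hxa hgR h rfl

theorem cross {A1 R1 A2 R2 E : Finset V} {a1 b1 a2 b2 x x' : V} {q1 q2 p : ℕ} (hd : 1 ≤ d)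
    (hA1 : Clq d red A1) (ha1 : a1 ∈ A1) (h1 : LP d red a1 b1 R1 q1)
    (hA2 : Clq d red A2) (ha2 : a2 ∈ A2) (h2 : LP d red a2 b2 R2 q2)
    (hdis : Disjoint (A1 ∪ R1) (A2 ∪ R2)) (hE : LP d red x x' E p)
    (hx : x ∈ A1) (hx' : x' ∈ A2) (hE1 : Disjoint E R1) (hE2 : Disjoint E R2)
    (hc1 : d ≤ ((A1 \ R1) \ E).card) (hc2 : d ≤ ((A2 \ R2) \ E).card) :
    ∃ U, LP d red b1 b2 U (q1 + 1 + p + (q2 + 1)) := by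
  have hxE := hE.start_mem
  have hxE' := hE.end_mem
  have ha1R := h1.start_mem
  have ha2R := h2.start_mem
  have hE1 := disj_out hE1
  have hE2 := disj_out hE2
  have hdis := disj_out hdis
  obtain ⟨g1, g11, g12, g13, g14, g15, g16, g17⟩ := extend hd hA1 ha1 h1 hx (hE1 _ hxE) hc1
  obtain ⟨g2, g21, g22, g23, g24, g25, g26, g27⟩ := extend hd hA2 ha2 h2 hx' (hE2 _ hxE') hc2
  have l1 := g17.rev.concat hE (X := _) (by
    intro y hy hyE
    rcases Finset.mem_union.1 hy with h | h
    · rcases g16 y h hyE with h | h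
      · exact h
      · exact absurd ha1R (hE1 _ (h ▸ hyE))
    · exact absurd h (hE1 _ hyE)) rfl
  have l2 := l1.concat g27 (X := _) (by
    intro y hy hyE
    rcases Finset.mem_union.1 hy with h | h
    · exfalso
      refine hdis y ?_ ?_
      · rcases Finset.mem_union.1 h with h | h
        · exact Finset.mem_union_left _ (g11 h)
        · exact Finset.mem_union_right _ h
      · rcases Finset.mem_union.1 hyE with h | h
        · exact Finset.mem_union_left _ (g21 h)
        · exact Finset.mem_union_right _ h
    · rcases Finset.mem_union.1 hyE with h' | h'
      · rcases g26 y h' h with h3 | h3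
        · exact h3
        · exact absurd ha2R (hE2 _ (h3 ▸ h))
      · exact absurd h' (hE2 _ h)) rfl
  exact ⟨_, l2⟩

theorem cliquePath (hd : 2 ≤ d) {b s : V} : ∀ (j : ℕ) {A R : Finset V} {a : V} {q : ℕ}, 1 ≤ j →
    Clq d red A → LP d red a b R q → a ∈ A → s ∈ A → s ≠ a → (∀ x ∈ A, x ∈ R → x = a) →
    j * d + 1 ≤ A.card → ∃ R', LP d red s b R' (q + j) ∧ R' ⊆ R ∪ A := by
  intro j
  induction j with
  | zero => intro A R a q h; omega
  | succ j ih =>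
    intro A R a q _ hA h ha hs hsa hAR hc
    rcases Nat.eq_zero_or_pos j with hj | hj
    · subst hj
      obtain ⟨g, hg, g1, g2, g3, g4, g5, g6⟩ := extend (Z := ∅) (by omega) hA ha h hs
        (fun hh => hsa (hAR s hs hh)) (by
          have : A.erase a ⊆ (A \ R) \ ∅ := by
            intro y hy
            rw [Finset.mem_erase] at hy
            simp only [Finset.sdiff_empty, Finset.mem_sdiff]
            exact ⟨hy.2, fun hh => hy.1 (hAR y hy.2 hh)⟩
          have h2 := Finset.card_le_card this
          rw [Finset.card_erase_of_mem ha] at h2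
          omega)
      refine ⟨g ∪ R, g6, ?_⟩
      grind
    · have hmul : (j + 1) * d = j * d + d := by ring
      have hjd : d ≤ j * d := Nat.le_mul_of_pos_left d hj
      have hcard : 1 < ((A.erase a).erase s).card := by
        rw [Finset.card_erase_of_mem (by simp [hs, hsa]), Finset.card_erase_of_mem ha]
        omega
      obtain ⟨t, ht⟩ : ((A.erase a).erase s).Nonempty := Finset.card_pos.1 (by omega)
      simp only [Finset.mem_erase] at ht
      obtain ⟨g, hg, g1, g2, g3, g4, g5, g6⟩ := extend (Z := {s}) (by omega) hA ha h ht.2.2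
        (fun hh => ht.2.1 (hAR t ht.2.2 hh)) (by
          have : (A.erase a).erase s ⊆ (A \ R) \ {s} := by
            intro y hy
            simp only [Finset.mem_erase] at hy
            simp only [Finset.mem_sdiff, Finset.mem_singleton]
            exact ⟨⟨hy.2.2, fun hh => hy.2.1 (hAR y hy.2.2 hh)⟩, hy.1⟩
          have h2 := Finset.card_le_card this
          rw [Finset.card_erase_of_mem (by simp [hs, hsa]), Finset.card_erase_of_mem ha] at h2
          omega)
      have hsg : s ∉ g := by
        intro hh
        rcases g5 s hh (by simp) with h3 | h3
        · exact ht.1 h3.symm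
        · exact hsa h3
      have hcA : (insert t (A \ g)).card = A.card - d := by
        rw [Finset.card_insert_of_notMem (by simp [g1]), Finset.card_sdiff_of_subset hg, g3]
        have := Finset.card_le_card hg
        omega
      obtain ⟨R', r1, r2⟩ := ih (A := insert t (A \ g)) hj (hA.mono (by grind)) g6 (by simp)
        (by simp [hs, hsg]) (fun hh => ht.1 hh.symm) (by grind) (by omega)
      refine ⟨R', by convert r1 using 1; omega, by grind⟩

/-- a blob -/
structure Blob (d : ℕ) (red : Finset V → Prop) (A R : Finset V) (a b : V) (q : ℕ) : Prop where
  clq : Clq d red A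
  lp : LP d red a b R q
  ne : a ≠ b
  ha : a ∈ A
  hb : b ∈ A
  inter : ∀ x ∈ A, x ∈ R → x = a ∨ x = b

variable {A R : Finset V} {a b : V} {q : ℕ}

theorem Blob.card_inter (h : Blob d red A R a b q) : (A ∩ R).card = 2 := by
  have h1 := h.lp.start_mem
  have h2 := h.lp.end_mem
  have h3 := h.ha
  have h4 := h.hb
  have : A ∩ R = {a, b} := by
    ext y
    have := h.inter y
    simp only [Finset.mem_inter, Finset.mem_insert, Finset.mem_singleton]
    constructor
    · rintro ⟨h5, h6⟩; exact this h5 h6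
    · rintro (rfl | rfl) <;> constructor <;> assumption
  rw [this, Finset.card_pair h.ne]

theorem Blob.card_core (h : Blob d red A R a b q) (Z : Finset V) :
    A.card ≤ ((A \ R) \ Z).card + 2 + Z.card := by
  have h1 := h.card_inter
  have h2 := Finset.card_inter_add_card_sdiff A R
  have h3 := Finset.le_card_sdiff Z (A \ R)
  omega

theorem Blob.span (hd : 2 ≤ d) (h : Blob d red A R a b q) {s t : V} (hs : s ∈ A \ R) (ht : t ∈ A \ R)
    (hst : s ≠ t) (hA : 2 * d + 4 ≤ A.card) :
    ∃ U j, LP d red s t U j ∧ U ⊆ A ∪ R ∧ (A ∪ R).card ≤ (j + 1) * d := by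
  rw [Finset.mem_sdiff] at hs ht
  have h1 := h.lp.start_mem
  have h2 := h.lp.end_mem
  obtain ⟨g, hg, g1, g2, g3, g4, g5, g6⟩ := extend (Z := {s}) (by omega) h.clq h.hb h.lp.rev ht.1 ht.2 (by
    have := h.card_core {s}
    simp at this ⊢; omega)
  have hsg : s ∉ g := by
    intro hh
    rcases g5 s hh (by simp) with h3 | h3
    · exact hst h3
    · exact hs.2 (h3 ▸ h2)
  have hag : a ∉ g := fun hh => h.ne (g4 a hh h1)
  have hcA : (A \ g).card = A.card - (d + 1) := by
    rw [Finset.card_sdiff_of_subset hg, g3]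
  have hj1 : (A.card - d - 2) / d * d ≤ A.card - d - 2 := Nat.div_mul_le_self _ _
  have hj2 : A.card - d - 2 < (A.card - d - 2) / d * d + d := Nat.lt_div_mul_add (by omega)
  have hj3 : 1 ≤ (A.card - d - 2) / d := by
    rw [Nat.one_le_div_iff (by omega)]; omega
  generalize (A.card - d - 2) / d = j at hj1 hj2 hj3
  obtain ⟨R', r1, r2⟩ := cliquePath (by omega) (b := t) (s := s) j (A := A \ g) hj3
    (h.clq.mono Finset.sdiff_subset) g6.rev (by simp [h.ha, hag]) (by simp [hs.1, hsg])
    (fun hh => hs.2 (hh ▸ h1)) (by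
      intro y hy hy2
      have := h.inter y
      grind) (by omega)
  refine ⟨R', _, r1, by grind, ?_⟩
  have h3 := h.card_inter
  have h4 := Finset.card_union_add_card_inter A R
  have h5 := h.lp.card_eq
  have : (q + 1 + j + 1) * d = q * d + d + j * d + d := by ring
  omega

theorem Blob.insertE (hd : 2 ≤ d) (h : Blob d red A R a b q) {x x' : V} {E : Finset V} {p : ℕ}
    (hx : x ∈ A) (hx' : x' ∈ A) (hxx : x ≠ x') (hE : LP d red x x' E p) (hER : Disjoint E R)
    (hA : E.card + d + 4 ≤ A.card) :
    ∃ A' R' a' q', Blob d red A' R' a' b q' ∧ A' ∪ R' = A ∪ R ∪ E ∧ q ≤ q' ∧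
      A.card ≤ A'.card + E.card + d + 1 := by
  have h1 := h.lp.start_mem
  have h2 := h.lp.end_mem
  have hxE := hE.start_mem
  have hxE' := hE.end_mem
  have hER := disj_out hER
  obtain ⟨g, hg, g1, g2, g3, g4, g5, g6⟩ := extend (Z := E) (by omega) h.clq h.ha h.lp hx'
    (hER _ hxE') (by
    have := h.card_core E
    omega)
  have l := hE.concat g6 (X := _) (by
    intro y hy hy2
    have h3 := hER y hy
    rcases Finset.mem_union.1 hy2 with h4 | h4
    · rcases g5 y h4 hy with h5 | h5
      · exact h5
      · exact absurd h1 (h5 ▸ h3)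
    · exact absurd h4 h3) rfl
  have hbg : b ∉ g := fun hh => h.ne (g4 b hh h2).symm
  have hbE : b ∉ E := fun hh => hER b hh h2
  refine ⟨insert x (A \ (E ∪ g)), E ∪ (g ∪ R), x, _, ⟨h.clq.mono ?_, l, ?_, by simp, ?_, ?_⟩, ?_, ?_, ?_⟩
  · intro y hy
    simp only [Finset.mem_insert, Finset.mem_sdiff] at hy
    rcases hy with rfl | hy
    · exact hx
    · exact hy.1
  · rintro rfl; exact hbE hxE
  · simp [h.hb, hbE, hbg]
  · intro y hy hy2
    have := h.inter y
    simp only [Finset.mem_insert, Finset.mem_sdiff, Finset.mem_union] at hy hy2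
    rcases hy with rfl | ⟨h3, h4⟩
    · left; rfl
    · rcases hy2 with h5 | h5 | h5
      · tauto
      · tauto
      · rcases this h3 h5 with rfl | rfl
        · exact absurd (Or.inr g2) h4
        · right; rfl
  · ext y
    have := @hg y
    simp only [Finset.mem_insert, Finset.mem_sdiff, Finset.mem_union]
    by_cases hyx : y = x
    · subst hyx; simp [hx]
    · by_cases hyg : y ∈ g
      · have := hg hyg; tauto
      · tauto
  · omega
  · have h3 := Finset.le_card_sdiff (E ∪ g) A
    have h4 := Finset.card_union_le E g
    have h5 := Finset.card_le_card (Finset.subset_insert x (A \ (E ∪ g)))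
    omega

end Cliq

section Stage1
variable {V : Type} [DecidableEq V] {d : ℕ} {red : Finset V → Prop}

/-- data of a stage one structure -/
structure SD (V : Type) where
  A : Finset V
  U : Finset V
  Y : Finset V
  a : V
  y : V
  q : ℕ

/-- support -/
def SD.supp (D : SD V) : Finset V := D.A ∪ D.U ∪ D.Y

/-- stage one structure -/
structure IsSt (d : ℕ) (red : Finset V → Prop) (t t' : ℕ) (X : Finset V) (D : SD V) : Prop where
  cA : Clq d red D.A
  cardA : D.A.card = t
  cY : Clq d red D.Y
  cardY : D.Y.card = t'
  dis : Disjoint D.A D.Y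
  lp : LP d red D.a D.y D.U D.q
  ha : D.a ∈ D.A
  hy : D.y ∈ D.Y
  iA : ∀ x ∈ D.A, x ∈ D.U → x = D.a
  iY : ∀ x ∈ D.Y, x ∈ D.U → x = D.y
  sub : D.supp ⊆ X

theorem isSt_exists (hd : 2 ≤ d) {t t' : ℕ} (ht : 1 ≤ t) (ht' : 1 ≤ t') {X K : Finset V}
    (hK : Clq d red K) (hKX : K ⊆ X) (hc : t + t' + d ≤ K.card) : ∃ D, IsSt d red t t' X D := by
  obtain ⟨A, hA, hAc⟩ := Finset.exists_subset_card_eq (show t ≤ K.card by omega)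
  have h1 := Finset.card_sdiff_of_subset hA
  obtain ⟨Y, hY, hYc⟩ := Finset.exists_subset_card_eq (show t' ≤ (K \ A).card by omega)
  have h2 := Finset.card_sdiff_of_subset hY
  obtain ⟨S, hS, hSc⟩ := Finset.exists_subset_card_eq (show d - 1 ≤ ((K \ A) \ Y).card by omega)
  obtain ⟨a, ha⟩ : A.Nonempty := Finset.card_pos.1 (by omega)
  obtain ⟨y, hy⟩ : Y.Nonempty := Finset.card_pos.1 (by omega)
  have hS' : ∀ z ∈ S, z ∈ K ∧ z ∉ A ∧ z ∉ Y := by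
    intro z hz
    have := hS hz
    simp only [Finset.mem_sdiff] at this
    tauto
  have hY' : ∀ z ∈ Y, z ∈ K ∧ z ∉ A := by
    intro z hz
    have := hY hz
    simpa only [Finset.mem_sdiff] using this
  have hay : a ≠ y := by rintro rfl; exact (hY' _ hy).2 ha
  have hec : (insert a (insert y S)).card = d + 1 := by
    rw [Finset.card_insert_of_notMem, Finset.card_insert_of_notMem]
    · omega
    · intro h; exact (hS' y h).2.2 hy
    · simp only [Finset.mem_insert, not_or]
      exact ⟨hay, fun h => (hS' a h).2.1 ha⟩
  have heK : insert a (insert y S) ⊆ K := by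
    intro z hz
    simp only [Finset.mem_insert] at hz
    rcases hz with rfl | rfl | hz
    · exact hA ha
    · exact (hY' _ hy).1
    · exact (hS' _ hz).1
  have l := LP.cons' (hK _ heK hec) hec (a := a) (b := y) (by simp) (by simp) hay
    (fun x _ hx => by simpa using hx) (LP.nil y) rfl
  refine ⟨⟨A, _, Y, a, y, _⟩, hK.mono hA, hAc, hK.mono (fun z hz => (hY' z hz).1), hYc, ?_, l, ha, hy,
    ?_, ?_, ?_⟩
  · rw [Finset.disjoint_left]; intro z hz hz'; exact (hY' z hz').2 hz
  · intro x hx hx'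
    simp only [Finset.mem_union, Finset.mem_insert, Finset.mem_singleton] at hx hx' ⊢
    grind
  · intro x hx hx'
    simp only [Finset.mem_union, Finset.mem_insert, Finset.mem_singleton] at hx hx' ⊢
    grind
  · refine subset_trans ?_ hKX
    intro x hx
    simp only [SD.supp, Finset.mem_union, Finset.mem_singleton] at hx
    rcases hx with (h | h | h) | h
    · exact hA h
    · exact heK h
    · rw [h]; exact (hY' _ hy).1
    · exact (hY' _ h).1

theorem isSt_max {Q t t' : ℕ} {X : Finset V} (hno : ∀ a b U q, LP d red a b U q → q < Q)
    (h : ∃ D, IsSt d red t t' X D) :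
    ∃ D, IsSt d red t t' X D ∧ ∀ D', IsSt d red t t' X D' → D'.q ≤ D.q := by
  by_contra hcon
  push Not at hcon
  have : ∀ m, ∃ D, IsSt d red t t' X D ∧ m ≤ D.q := by
    intro m
    induction m with
    | zero => obtain ⟨D, hD⟩ := h; exact ⟨D, hD, by omega⟩
    | succ m ih =>
      obtain ⟨D, hD, hm⟩ := ih
      obtain ⟨D', hD', hm'⟩ := hcon D hD
      exact ⟨D', hD', by omega⟩
  obtain ⟨D, hD, hm⟩ := this Q
  have := hno _ _ _ _ hD.lp
  omega

theorem IsSt.supp_card {Q t t' : ℕ} {X : Finset V} {D : SD V} (hd : 1 ≤ d) (h : IsSt d red t t' X D)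
    (hno : ∀ a b U q, LP d red a b U q → q < Q) : D.supp.card ≤ Q * d + t + t' := by
  have h1 := Finset.card_union_le (D.A ∪ D.U) D.Y
  have h2 := Finset.card_union_le D.A D.U
  have h3 := h.lp.card_eq
  have h4 := hno _ _ _ _ h.lp
  have h5 : (D.q + 1) * d ≤ Q * d := Nat.mul_le_mul_right _ h4
  have h6 : (D.q + 1) * d = D.q * d + d := by ring
  have h7 := h.cardA
  have h8 := h.cardY
  unfold SD.supp
  omega

theorem IsSt.card_core {t t' : ℕ} {X : Finset V} {D : SD V} (h : IsSt d red t t' X D) (Z : Finset V) :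
    t ≤ ((D.A \ D.U) \ Z).card + 1 + Z.card := by
  have h1 : D.A.erase D.a ⊆ D.A \ D.U := by
    intro x hx
    rw [Finset.mem_erase] at hx
    rw [Finset.mem_sdiff]
    exact ⟨hx.2, fun hh => hx.1 (h.iA x hx.2 hh)⟩
  have h2 := Finset.card_le_card h1
  rw [Finset.card_erase_of_mem h.ha, h.cardA] at h2
  have h3 := Finset.le_card_sdiff Z (D.A \ D.U)
  omega

/-- The improving step. -/
theorem IsSt.improve {t t' : ℕ} {X : Finset V} {D : SD V} (hd : 2 ≤ d) (h : IsSt d red t t' X D)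
    (ht : 2 * d + 4 ≤ t) {e C : Finset V} (he : red e) (hec : e.card = d + 1) (heX : e ⊆ X)
    (heD : ∀ x ∈ e, x ∈ D.supp → x ∈ D.A \ D.U) {w z : V} (hw : w ∈ e) (hwD : w ∈ D.supp)
    (hz : z ∈ e) (hzC : z ∈ C) (hC : Clq d red C) (hCX : C ⊆ X) (hCD : Disjoint C D.supp)
    (hCc : t + d ≤ C.card) : ∃ D', IsSt d red t t' X D' ∧ D.q < D'.q := by
  have hwA := heD w hw hwD
  rw [Finset.mem_sdiff] at hwA
  have haU := h.lp.start_mem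
  have hCD := disj_out hCD
  have hsupp : ∀ x, x ∈ D.supp ↔ (x ∈ D.A ∨ x ∈ D.U) ∨ x ∈ D.Y := by
    intro x; simp [SD.supp, or_assoc]
  have hAY := disj_out h.dis
  have heU : ∀ x ∈ e, x ∉ D.U := by
    intro x hx hxU
    have := heD x hx ((hsupp x).2 (Or.inl (Or.inr hxU)))
    rw [Finset.mem_sdiff] at this
    exact this.2 hxU
  have heY : ∀ x ∈ e, x ∉ D.Y := by
    intro x hx hxU
    have := heD x hx ((hsupp x).2 (Or.inr hxU))
    rw [Finset.mem_sdiff] at this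
    exact hAY x this.1 hxU
  obtain ⟨g, hg, g1, g2, g3, g4, g5, g6⟩ := extend (Z := e) (by omega) h.cA h.ha h.lp hwA.1 hwA.2
    (by have := h.card_core e; omega)
  have hzw : z ≠ w := by
    rintro rfl; exact hCD z hzC hwD
  have l := LP.cons' he hec hz hw hzw (by
    intro x hx hx2
    rcases Finset.mem_union.1 hx2 with h1 | h1
    · rcases g5 x h1 hx with h2 | h2
      · exact h2
      · exact absurd haU (h2 ▸ heU x hx)
    · exact absurd h1 (heU x hx)) g6 rfl
  have hwC : w ∉ C := fun hh => hCD w hh hwD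
  have h3 : (C ∩ e).card ≤ d := by
    have : C ∩ e ⊆ e.erase w := by
      intro x hx
      rw [Finset.mem_inter] at hx
      rw [Finset.mem_erase]
      exact ⟨by rintro rfl; exact hwC hx.1, hx.2⟩
    have := Finset.card_le_card this
    rw [Finset.card_erase_of_mem hw] at this
    omega
  have h4 := Finset.card_inter_add_card_sdiff C e
  obtain ⟨A', hA', hA'c⟩ := Finset.exists_subset_card_eq (show t - 1 ≤ (C \ e).card by omega)
  have hA'' : ∀ x ∈ A', x ∈ C ∧ x ∉ e := fun x hx => by simpa using hA' hx
  refine ⟨⟨insert z A', _, D.Y, z, D.y, _⟩, ⟨hC.mono ?_, ?_, h.cY, h.cardY, ?_, l, by simp, h.hy, ?_, ?_, ?_⟩,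
    by simp only; omega⟩
  · intro x hx
    rcases Finset.mem_insert.1 hx with rfl | hx
    · exact hzC
    · exact (hA'' x hx).1
  · rw [Finset.card_insert_of_notMem (fun hh => (hA'' z hh).2 hz)]; omega
  · rw [Finset.disjoint_left]
    intro x hx hx2
    refine hCD x ?_ ((hsupp x).2 (Or.inr hx2))
    rcases Finset.mem_insert.1 hx with rfl | hx
    · exact hzC
    · exact (hA'' x hx).1
  · intro x hx hx2
    simp only at hx hx2 ⊢
    rcases Finset.mem_insert.1 hx with rfl | hx
    · rfl
    · exfalso
      obtain ⟨h5, h6⟩ := hA'' x hx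
      have h7 := hCD x h5
      rw [hsupp] at h7
      simp only [Finset.mem_union] at hx2
      have := @hg x
      tauto
  · intro x hx hx2
    simp only at hx hx2 ⊢
    simp only [Finset.mem_union] at hx2
    rcases hx2 with h5 | h5 | h5
    · exact absurd hx (heY x h5)
    · exact absurd hx (hAY x (hg h5))
    · exact h.iY x hx h5
  · intro x hx
    have hs : x ∈ D.supp → x ∈ X := fun hh => h.sub hh
    rw [hsupp] at hs
    simp only [SD.supp, Finset.mem_union, Finset.mem_insert] at hx
    have h5 := @hg x
    have h6 := @heX x
    rcases hx with ((rfl | h7) | h7 | h7 | h7) | h7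
    · exact h6 hz
    · exact hCX (hA'' x h7).1
    · exact h6 h7
    · tauto
    · tauto
    · tauto

theorem stage1 [Fintype V] {nH ρ Q : ℕ} (hd : 2 ≤ d) (hρ : 1 ≤ ρ) (H : Finset (Finset (Fin nH)))
    (hHu : IsUniformHyp (d + 1) H) (c : Finset V → Bool) (hr : chromNum H = ρ + 1)
    (hnb : ¬ hasMonoCopy c false H)
    (hno : ∀ a b U q, LP d (fun e => c e = true) a b U q → q < Q) (T0 T' : ℕ)
    (hT0 : nH + 2 * d + 4 ≤ T0) (hT' : 1 ≤ T') (Dn : ℕ → ℕ)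
    (hDn : ∀ t, ∀ X : Finset V, Dn t ≤ X.card → ∃ K ⊆ X, K.card = t ∧ Clq d (fun e => c e = true) K)
    (hN : ρ * (Q * d) ≤ Fintype.card V) (Tm : ℕ) (hTm : Tm = T0 + (d + 1) * ρ)
    (hQ : Dn (Tm + T' + d) + ρ * (Tm + T') ≤ Q * d) :
    ∃ (P : ℕ → SD V) (X : Finset V), X.card < Dn Tm ∧
      (∀ i < ρ, IsSt d (fun e => c e = true) (T0 + (d + 1) * i) T' Finset.univ (P i)) ∧
      (∀ i j, i < j → j < ρ → Disjoint (P i).supp (P j).supp) ∧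
      Fintype.card V ≤ X.card + ∑ i ∈ Finset.range ρ, (P i).supp.card := by
  set red : Finset V → Prop := fun e => c e = true with hred
  have hTi : ∀ i, i ≤ ρ → T0 + (d + 1) * i ≤ Tm := by
    intro i hi
    have := Nat.mul_le_mul_left (d + 1) hi
    omega
  have hne : Nonempty V := by
    rw [← Fintype.card_pos_iff]
    have : 1 * (Tm + T') ≤ ρ * (Tm + T') := Nat.mul_le_mul_right _ hρ
    have : 1 * (Q * d) ≤ ρ * (Q * d) := Nat.mul_le_mul_right _ hρ
    omega
  have hbest : ∀ (i : ℕ) (X : Finset V), ∃ D : SD V, i < ρ → Dn (Tm + T' + d) ≤ X.card →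
      (IsSt d red (T0 + (d + 1) * i) T' X D ∧
        ∀ D', IsSt d red (T0 + (d + 1) * i) T' X D' → D'.q ≤ D.q) := by
    intro i X
    by_cases hi : i < ρ ∧ Dn (Tm + T' + d) ≤ X.card
    · obtain ⟨K, hK, hKc, hKq⟩ := hDn _ X hi.2
      have := hTi i hi.1.le
      obtain ⟨D, hD⟩ := isSt_max hno (isSt_exists hd (t := T0 + (d + 1) * i) (by omega) hT' hKq hK (by omega))
      exact ⟨D, fun _ _ => hD⟩
    · obtain ⟨v⟩ := hne
      exact ⟨⟨∅, ∅, ∅, v, v, 0⟩, fun h1 h2 => absurd ⟨h1, h2⟩ hi⟩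
  choose best hb using hbest
  let rest : ℕ → Finset V := fun n => Nat.rec Finset.univ (fun i X => X \ (best i X).supp) n
  have hrest0 : rest 0 = Finset.univ := rfl
  have hrestS : ∀ i, rest (i + 1) = rest i \ (best i (rest i)).supp := fun i => rfl
  clear_value rest
  obtain ⟨P, hP⟩ : ∃ P : ℕ → SD V, ∀ i, P i = best i (rest i) := ⟨_, fun i => rfl⟩
  simp only [← hP] at hrestS
  have hb' : ∀ i < ρ, Dn (Tm + T' + d) ≤ (rest i).card →
      (IsSt d red (T0 + (d + 1) * i) T' (rest i) (P i) ∧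
        ∀ D', IsSt d red (T0 + (d + 1) * i) T' (rest i) D' → D'.q ≤ (P i).q) := by
    intro i; rw [hP]; exact hb i (rest i)
  clear hb hP
  have hcard : ∀ i, i ≤ ρ → Fintype.card V ≤ (rest i).card + i * (Q * d + (Tm + T')) := by
    intro i
    induction i with
    | zero => intro _; rw [hrest0]; simp
    | succ i ih =>
      intro hi
      have ih := ih (by omega)
      have h1 : (i + 1) * (Q * d) ≤ ρ * (Q * d) := Nat.mul_le_mul_right _ hi
      have h2 : i * (Tm + T') ≤ ρ * (Tm + T') := Nat.mul_le_mul_right _ (by omega)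
      have h3 : (i + 1) * (Q * d) = i * (Q * d) + Q * d := by ring
      have h4 : i * (Q * d + (Tm + T')) = i * (Q * d) + i * (Tm + T') := by ring
      have h5 : (i + 1) * (Q * d + (Tm + T')) = i * (Q * d + (Tm + T')) + (Q * d + (Tm + T')) := by ring
      have h6 := (hb' i (by omega) (by omega)).1.supp_card (by omega) hno
      have h7 := hTi i (by omega)
      have h8 := Finset.le_card_sdiff (P i).supp (rest i)
      rw [hrestS]
      omega
  have hPP : ∀ i < ρ, (IsSt d red (T0 + (d + 1) * i) T' (rest i) (P i) ∧
        ∀ D', IsSt d red (T0 + (d + 1) * i) T' (rest i) D' → D'.q ≤ (P i).q) := by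
    intro i hi
    apply hb' i hi
    have := hcard i hi.le
    have h1 : (i + 1) * (Q * d) ≤ ρ * (Q * d) := Nat.mul_le_mul_right _ hi
    have h2 : i * (Tm + T') ≤ ρ * (Tm + T') := Nat.mul_le_mul_right _ (by omega)
    have h3 : (i + 1) * (Q * d) = i * (Q * d) + Q * d := by ring
    have h4 : i * (Q * d + (Tm + T')) = i * (Q * d) + i * (Tm + T') := by ring
    omega
  have hanti : ∀ i j, i ≤ j → rest j ⊆ rest i := by
    intro i j hij
    induction hij with
    | refl => exact subset_rfl
    | step h ih => rw [hrestS]; exact Finset.sdiff_subset.trans ih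
  have hdisR : ∀ i j, i < j → Disjoint (P i).supp (rest j) := by
    intro i j hij
    refine Finset.disjoint_of_subset_right (hanti (i + 1) j hij) ?_
    rw [hrestS]; exact Finset.disjoint_sdiff
  refine ⟨P, rest ρ, ?_, ?_, ?_, ?_⟩
  · by_contra hcon
    push Not at hcon
    obtain ⟨K, hK, hKc, hKq⟩ := hDn _ _ hcon
    let C : ℕ → Finset V := fun i => if i < ρ then (P i).A \ (P i).U else K
    have hC1 : ∀ i < ρ, C i = (P i).A \ (P i).U := fun i hi => if_pos hi
    have hC2 : C ρ = K := if_neg (lt_irrefl _)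
    clear_value C
    have hCs : ∀ i < ρ, C i ⊆ (P i).supp := by
      intro i hi x hx
      rw [hC1 i hi, Finset.mem_sdiff] at hx
      simp [SD.supp, hx.1]
    have hCr : ∀ i ≤ ρ, C i ⊆ rest i := by
      intro i hi
      rcases Nat.lt_or_ge i ρ with h | h
      · exact (hCs i h).trans (hPP i h).1.sub
      · have : i = ρ := by omega
        subst this
        rw [hC2]; exact hK
    have hCq : ∀ i ≤ ρ, Clq d red (C i) := by
      intro i hi
      rcases Nat.lt_or_ge i ρ with h | h
      · rw [hC1 i h]; exact (hPP i h).1.cA.mono Finset.sdiff_subset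
      · have : i = ρ := by omega
        subst this
        rw [hC2]; exact hKq
    have hCc : ∀ i ≤ ρ, T0 + (d + 1) * i ≤ (C i).card + 1 := by
      intro i hi
      rcases Nat.lt_or_ge i ρ with h | h
      · rw [hC1 i h]
        have := (hPP i h).1.card_core ∅
        simpa using this
      · have : i = ρ := by omega
        subst this
        rw [hC2]; omega
    have hCd : ∀ i j, i < j → j ≤ ρ → Disjoint (C i) (C j) := by
      intro i j hij hj
      exact Finset.disjoint_of_subset_left (hCs i (by omega))
        (Finset.disjoint_of_subset_right (hCr j hj) (hdisR i j hij))
    obtain ⟨e, he, hec, he1, he2⟩ := embedN (by omega) H hHu c hr hnb C hCd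
      (fun i hi => by have := hCc i hi.le; omega)
      (by have := hCc ρ le_rfl
          have := sigma_le (by omega) H hHu (by omega)
          omega)
    have hex : ∃ i, i ≤ ρ ∧ ∃ x ∈ e, x ∈ C i := by
      obtain ⟨x, hx⟩ : e.Nonempty := Finset.card_pos.1 (by omega)
      obtain ⟨i, hi, hxi⟩ := he1 x hx
      exact ⟨i, hi, x, hx, hxi⟩
    obtain ⟨i, ⟨hi, w, hwe, hwi⟩, himin⟩ : ∃ i, (i ≤ ρ ∧ ∃ x ∈ e, x ∈ C i) ∧
        ∀ j, (j ≤ ρ ∧ ∃ x ∈ e, x ∈ C j) → i ≤ j :=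
      ⟨Nat.find hex, Nat.find_spec hex, fun j hj => Nat.find_min' hex hj⟩
    obtain ⟨z, hze, hzi⟩ := Finset.not_subset.1 (he2 i hi)
    obtain ⟨l, hl, hzl⟩ := he1 z hze
    have hil : i < l := by
      have := himin l ⟨hl, z, hze, hzl⟩
      rcases Nat.lt_or_ge i l with h | h
      · exact h
      · have : i = l := by omega
        exact absurd hzl (this ▸ hzi)
    have hiρ : i < ρ := by omega
    obtain ⟨hst, hmax⟩ := hPP i hiρ
    have hmul : (d + 1) * (i + 1) ≤ (d + 1) * l := Nat.mul_le_mul_left _ hil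
    have hmul2 : (d + 1) * (i + 1) = (d + 1) * i + (d + 1) := by ring
    have hcl := hCc l hl
    obtain ⟨D', hD', hq⟩ := hst.improve hd (by omega) he hec (C := C l) (w := w) (z := z) (by
        intro x hx
        obtain ⟨j, hj, hxj⟩ := he1 x hx
        exact hanti i j (himin j ⟨hj, x, hx, hxj⟩) (hCr j hj hxj)) (by
        intro x hx hxs
        obtain ⟨j, hj, hxj⟩ := he1 x hx
        have h1 := himin j ⟨hj, x, hx, hxj⟩
        rcases Nat.lt_or_ge i j with h | h
        · exact absurd (hCr j hj hxj) (disj_out (hdisR i j h) x hxs)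
        · have : i = j := by omega
          subst this
          rw [← hC1 i hiρ]; exact hxj) hwe (hCs i hiρ hwi) hze hzl (hCq l hl)
        ((hCr l hl).trans (hanti i l hil.le))
        (Finset.disjoint_of_subset_left (hCr l hl) (hdisR i l hil).symm) (by omega)
    have := hmax D' hD'
    omega
  · intro i hi
    obtain ⟨⟨h1, h2, h3, h4, h5, h6, h7, h8, h9, h10, h11⟩, -⟩ := hPP i hi
    exact ⟨h1, h2, h3, h4, h5, h6, h7, h8, h9, h10, Finset.subset_univ _⟩
  · intro i j hij hj
    exact Finset.disjoint_of_subset_right (hPP j hj).1.sub (hdisR i j hij)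
  · have : ∀ i, Fintype.card V ≤ (rest i).card + ∑ j ∈ Finset.range i, (P j).supp.card := by
      intro i
      induction i with
      | zero => rw [hrest0]; simp
      | succ i ih =>
        rw [Finset.sum_range_succ, hrestS]
        have := Finset.le_card_sdiff (P i).supp (rest i)
        omega
    exact this ρ

end Stage1

section Closing
variable {V : Type} [DecidableEq V] {d : ℕ} {red : Finset V → Prop}

theorem LP.single {e : Finset V} {x y : V} (h1 : red e) (h2 : e.card = d + 1) (hx : x ∈ e) (hy : y ∈ e)
    (hxy : x ≠ y) : LP d red x y e 1 := by
  refine LP.cons' h1 h2 hx hy hxy (fun z _ hz => by simpa using hz) (LP.nil y) ?_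
  ext z
  simp only [Finset.mem_union, Finset.mem_singleton]
  constructor
  · exact Or.inl
  · rintro (h | rfl)
    · exact h
    · exact hy

/-- swapped structure -/
def SD.swap (D : SD V) : SD V := ⟨D.Y, D.U, D.A, D.y, D.a, D.q⟩

theorem IsSt.swap {t t' : ℕ} {X : Finset V} {D : SD V} (h : IsSt d red t t' X D) :
    IsSt d red t' t X D.swap := by
  refine ⟨h.cY, h.cardY, h.cA, h.cardA, h.dis.symm, h.lp.rev, h.hy, h.ha, h.iY, h.iA, ?_⟩
  refine subset_trans ?_ h.sub
  intro x hx
  simp only [SD.supp, SD.swap, Finset.mem_union] at hx ⊢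
  tauto

theorem IsSt.close {t t' : ℕ} {X : Finset V} {D : SD V} (hd : 2 ≤ d) (h : IsSt d red t t' X D)
    (ht : 2 * d + 4 ≤ t) {e : Finset V} (he : red e) (hec : e.card = d + 1)
    (heD : ∀ x ∈ e, x ∈ D.A \ D.U ∨ x ∈ D.Y \ D.U) {w z : V} (hw : w ∈ e) (hwD : w ∈ D.A)
    (hz : z ∈ e) (hzD : z ∈ D.Y) : ∃ A R a b q, Blob d red A R a b q ∧ A ∪ R ⊆ D.supp ∧
      D.supp.card ≤ (A ∪ R).card + t ∧ t' ≤ A.card + (d + 1) ∧ D.q ≤ q := by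
  have haU := h.lp.start_mem
  have hyU := h.lp.end_mem
  have hAY := disj_out h.dis
  have heU : ∀ x ∈ e, x ∉ D.U := by
    intro x hx
    rcases heD x hx with h1 | h1 <;> exact (Finset.mem_sdiff.1 h1).2
  obtain ⟨g, hg, g1, g2, g3, g4, g5, g6⟩ := extend (Z := e) (by omega) h.cA h.ha h.lp hwD (heU w hw)
    (by have := h.card_core e; omega)
  have hzw : z ≠ w := by
    rintro rfl; exact hAY z hwD hzD
  have l := LP.cons' he hec hz hw hzw (by
    intro x hx hx2
    rcases Finset.mem_union.1 hx2 with h1 | h1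
    · rcases g5 x h1 hx with h2 | h2
      · exact h2
      · exact absurd haU (h2 ▸ heU x hx)
    · exact absurd h1 (heU x hx)) g6 rfl
  refine ⟨insert z (D.Y \ e), _, z, D.y, _, ⟨h.cY.mono ?_, l, ?_, by simp, ?_, ?_⟩, ?_, ?_, ?_, by omega⟩
  · intro x hx
    rcases Finset.mem_insert.1 hx with rfl | hx
    · exact hzD
    · exact (Finset.mem_sdiff.1 hx).1
  · intro hh; exact heU z hz (hh ▸ hyU)
  · have : D.y ∉ e := fun hh => heU _ hh hyU
    simp [h.hy, this]
  · intro x hx hx2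
    rcases Finset.mem_insert.1 hx with rfl | hx
    · left; rfl
    · rw [Finset.mem_sdiff] at hx
      simp only [Finset.mem_union] at hx2
      rcases hx2 with h5 | h5 | h5
      · exact absurd h5 hx.2
      · exact absurd hx.1 (hAY x (hg h5))
      · right; exact h.iY x hx.1 h5
  · intro x hx
    have h1 := @hg x
    have h2 := heD x
    simp only [SD.supp, Finset.mem_union, Finset.mem_insert, Finset.mem_sdiff] at hx h2 ⊢
    rcases hx with (rfl | h3) | h3
    · right; exact hzD
    · right; exact h3.1
    · tauto
  · rw [← h.cardA]
    refine le_trans (Finset.card_le_card ?_) (Finset.card_union_le _ _)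
    intro x hx
    simp only [SD.supp, Finset.mem_union, Finset.mem_insert, Finset.mem_sdiff] at hx ⊢
    by_cases hxe : x ∈ e
    · tauto
    · tauto
  · have h1 := Finset.le_card_sdiff e D.Y
    have h2 := Finset.card_le_card (Finset.subset_insert z (D.Y \ e))
    have h3 := h.cardY
    omega

theorem closing {nH ρ Q : ℕ} (hd : 2 ≤ d) (H : Finset (Finset (Fin nH))) {X : Finset V}
    (hHu : IsUniformHyp (d + 1) H) (c : Finset V → Bool) (hr : chromNum H = ρ + 1)
    (hnb : ¬ hasMonoCopy c false H)
    (hno : ∀ a b U q, LP d (fun e => c e = true) a b U q → q < Q) (t : ℕ → ℕ) (T' : ℕ)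
    (ht : ∀ i < ρ, nH + 2 * d + 4 ≤ t i) (hT' : nH + 2 * d + 4 ≤ T') (P : ℕ → SD V)
    (hP : ∀ i < ρ, IsSt d (fun e => c e = true) (t i) T' X (P i))
    (hPd : ∀ i j, i < j → j < ρ → Disjoint (P i).supp (P j).supp)
    (hPq : ∀ i < ρ, Q ≤ 2 * (P i).q) (i : ℕ) (hi : i < ρ) :
    ∃ A R a b q, Blob d (fun e => c e = true) A R a b q ∧ A ∪ R ⊆ (P i).supp ∧
      (P i).supp.card ≤ (A ∪ R).card + t i ∧ T' ≤ A.card + (d + 1) ∧ (P i).q ≤ q := by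
  set red : Finset V → Prop := fun e => c e = true with hred
  have hPd' : ∀ i j, i < ρ → j < ρ → i ≠ j → Disjoint (P i).supp (P j).supp := by
    intro i j hi hj hij
    rcases lt_or_gt_of_ne hij with h | h
    · exact hPd i j h hj
    · exact (hPd j i h hi).symm
  let S : ℕ → SD V := fun m => if m < ρ then P m else (P i).swap
  have hS1 : ∀ m < ρ, S m = P m := fun m hm => if_pos hm
  have hS2 : S ρ = (P i).swap := if_neg (lt_irrefl _)
  clear_value S
  have hSt : ∀ m ≤ ρ, ∃ t1 t2, nH + 2 * d + 4 ≤ t1 ∧ IsSt d red t1 t2 X (S m) ∧ Q ≤ 2 * (S m).q := by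
    intro m hm
    rcases Nat.lt_or_ge m ρ with h | h
    · rw [hS1 m h]; exact ⟨_, _, ht m h, hP m h, hPq m h⟩
    · have : m = ρ := by omega
      rw [this, hS2]
      exact ⟨_, _, hT', (hP i hi).swap, hPq i hi⟩
  have hsw : (P i).swap.supp = (P i).supp := by
    ext x; simp only [SD.supp, SD.swap, Finset.mem_union]; tauto
  have hSd : ∀ j l, j < l → l ≤ ρ → ¬ (j = i ∧ l = ρ) → Disjoint (S j).supp (S l).supp := by
    intro j l hjl hl hne
    rw [hS1 j (by omega)]
    rcases Nat.lt_or_ge l ρ with h | h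
    · rw [hS1 l h]; exact hPd j l hjl h
    · have : l = ρ := by omega
      subst this
      rw [hS2, hsw]
      exact hPd' j i hjl hi (fun h => hne ⟨h, rfl⟩)
  obtain ⟨C, hC⟩ : ∃ C : ℕ → Finset V, ∀ m, C m = (S m).A \ (S m).U := ⟨_, fun m => rfl⟩
  have hCs : ∀ m, C m ⊆ (S m).supp := by
    intro m x hx
    rw [hC, Finset.mem_sdiff] at hx
    simp [SD.supp, hx.1]
  have hCd : ∀ j l, j < l → l ≤ ρ → Disjoint (C j) (C l) := by
    intro j l hjl hl
    by_cases hne : j = i ∧ l = ρ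
    · rw [hne.1, hne.2, hC, hC, hS1 i hi, hS2]
      exact Finset.disjoint_of_subset_left Finset.sdiff_subset
        (Finset.disjoint_of_subset_right Finset.sdiff_subset (hP i hi).dis)
    · exact Finset.disjoint_of_subset_left (hCs j)
        (Finset.disjoint_of_subset_right (hCs l) (hSd j l hjl hl hne))
  have hCc : ∀ m ≤ ρ, nH + 2 * d + 3 ≤ (C m).card := by
    intro m hm
    obtain ⟨t1, t2, h1, h2, -⟩ := hSt m hm
    have := h2.card_core ∅
    rw [hC]
    simp at this
    omega
  obtain ⟨e, he, hec, he1, he2⟩ := embedN (by omega) H hHu c hr hnb C hCd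
      (fun i hi => by have := hCc i hi.le; omega)
      (by have := hCc ρ le_rfl
          have := sigma_le (by omega) H hHu (by omega)
          omega)
  have hSU : ∀ m j, m ≤ ρ → j ≤ ρ → Disjoint (C m) (S j).U := by
    have hsub : ∀ j, (S j).U ⊆ (S j).supp := by
      intro j x hx; simp [SD.supp, hx]
    have hUi : (S ρ).U = (S i).U := by rw [hS2, hS1 i hi]; rfl
    have hself : ∀ m, Disjoint (C m) (S m).U := by
      intro m; rw [hC]; exact Finset.sdiff_disjoint
    intro m j hm hj
    by_cases hmj : m = j
    · subst hmj; exact hself m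
    · by_cases h1 : m = i ∧ j = ρ
      · rw [h1.1, h1.2, hUi]; exact hself i
      · by_cases h2 : j = i ∧ m = ρ
        · rw [h2.1, h2.2, ← hUi]; exact hself ρ
        · rcases lt_or_gt_of_ne hmj with h | h
          · exact Finset.disjoint_of_subset_left (hCs m)
              (Finset.disjoint_of_subset_right (hsub j) (hSd m j h hj h1))
          · exact Finset.disjoint_of_subset_left (hCs m)
              (Finset.disjoint_of_subset_right (hsub j) (hSd j m h hm h2).symm)
  have heU : ∀ j ≤ ρ, Disjoint e (S j).U := by
    intro j hj
    rw [Finset.disjoint_left]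
    intro x hx
    obtain ⟨m, hm, hxm⟩ := he1 x hx
    exact disj_out (hSU m j hm hj) x hxm
  have key : ∀ j l x x', j < l → l ≤ ρ → x ∈ e → x' ∈ e → x ∈ C j → x' ∈ C l → j = i ∧ l = ρ := by
    intro j l x x' hjl hl hx hx' hxj hxl
    by_contra hne
    obtain ⟨t1, t2, h1, h2, h3⟩ := hSt j (by omega)
    obtain ⟨t1', t2', h1', h2', h3'⟩ := hSt l hl
    have hxx : x ≠ x' := by
      rintro rfl; exact disj_out (hCd j l hjl hl) x hxj hxl
    have hsub : ∀ j, (S j).A ∪ (S j).U ⊆ (S j).supp := by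
      intro j; exact Finset.subset_union_left
    rw [hC, Finset.mem_sdiff] at hxj hxl
    obtain ⟨U, hU⟩ := cross (by omega) h2.cA h2.ha h2.lp h2'.cA h2'.ha h2'.lp
      (Finset.disjoint_of_subset_left (hsub j)
        (Finset.disjoint_of_subset_right (hsub l) (hSd j l hjl hl hne)))
      (LP.single he hec hx hx' hxx) hxj.1 hxl.1 (heU j (by omega)) (heU l hl)
      (by have := h2.card_core e; omega) (by have := h2'.card_core e; omega)
    have := hno _ _ _ _ hU
    omega
  obtain ⟨w, z, hw, hz, hwi, hzr⟩ : ∃ w z, w ∈ e ∧ z ∈ e ∧ w ∈ C i ∧ z ∈ C ρ := by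
    obtain ⟨x, hx⟩ : e.Nonempty := Finset.card_pos.1 (by omega)
    obtain ⟨j, hj, hxj⟩ := he1 x hx
    obtain ⟨x', hx', hxj'⟩ := Finset.not_subset.1 (he2 j hj)
    obtain ⟨l, hl, hxl⟩ := he1 x' hx'
    have hjl : j ≠ l := by rintro rfl; exact hxj' hxl
    rcases lt_or_gt_of_ne hjl with h | h
    · obtain ⟨rfl, rfl⟩ := key j l x x' h hl hx hx' hxj hxl
      exact ⟨x, x', hx, hx', hxj, hxl⟩
    · obtain ⟨rfl, rfl⟩ := key l j x' x h hj hx' hx hxl hxj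
      exact ⟨x', x, hx', hx, hxl, hxj⟩
  have hCi : C i = (P i).A \ (P i).U := by rw [hC, hS1 i hi]
  have hCρ : C ρ = (P i).Y \ (P i).U := by rw [hC, hS2]; rfl
  refine (hP i hi).close hd (by have := ht i hi; omega) he hec ?_ hw (w := w) (z := z) ?_ hz ?_
  · intro x hx
    obtain ⟨m, hm, hxm⟩ := he1 x hx
    rcases Nat.lt_or_ge m ρ with h | h
    · obtain ⟨h1, -⟩ := key m ρ x z h le_rfl hx hz hxm hzr
      left; rw [← hCi, ← h1]; exact hxm
    · have : m = ρ := by omega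
      right; rw [← hCρ, ← this]; exact hxm
  · rw [hCi] at hwi; exact (Finset.mem_sdiff.1 hwi).1
  · rw [hCρ] at hzr; exact (Finset.mem_sdiff.1 hzr).1

end Closing

section Stage2
variable {V : Type} [DecidableEq V] {d : ℕ}

/-- blob data -/
structure BD (V : Type) where
  A : Finset V
  R : Finset V
  a : V
  b : V
  q : ℕ

/-- body of a blob -/
def BD.body (D : BD V) : Finset V := D.A ∪ D.R

/-- core of a blob -/
def BD.core (D : BD V) : Finset V := D.A \ D.R

theorem BD.core_sub (D : BD V) : D.core ⊆ D.body :=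
  fun _ hx => Finset.mem_union_left _ (Finset.mem_sdiff.1 hx).1

/-- configuration -/
structure Conf (d : ℕ) (red : Finset V → Prop) (ρ Q L s : ℕ) (β : ℕ → BD V) : Prop where
  blob : ∀ i < ρ, Blob d red (β i).A (β i).R (β i).a (β i).b (β i).q
  dis : ∀ i j, i < ρ → j < ρ → i ≠ j → Disjoint (β i).body (β j).body
  big : ∀ i < ρ, L ≤ (β i).A.card
  long : ∀ i < ρ, Q ≤ 2 * (β i).q
  sum : s ≤ ∑ i ∈ Finset.range ρ, (β i).body.card

theorem Blob.attach2 {red : Finset V → Prop} {A R : Finset V} {a b : V} {q Q : ℕ} (hd : 2 ≤ d)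
    (h : Blob d red A R a b q) (hA : 2 * d + 4 ≤ A.card)
    (hno : ∀ a b U q, LP d red a b U q → q < Q) {f f' : Finset V} {x x' : V}
    (hx : x ∈ A \ R) (hx' : x' ∈ A \ R) (hxx : x ≠ x') (hf : Disjoint f (A ∪ R)) (hf' : Disjoint f' (A ∪ R))
    (hff : Disjoint f f') (hfc : f.card = d) (hfc' : f'.card = d) (hr : red (insert x f))
    (hr' : red (insert x' f')) : (A ∪ R).card + 2 * d ≤ Q * d ∧ (A ∪ R).card + d ≤ Q * d := by
  obtain ⟨U, j, hU, hUs, hj⟩ := h.span hd hx hx' hxx hA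
  have hf := disj_out hf
  have hf' := disj_out hf'
  have hff := disj_out hff
  have hxU : x ∈ A ∪ R := Finset.mem_union_left _ (Finset.mem_sdiff.1 hx).1
  have hxU' : x' ∈ A ∪ R := Finset.mem_union_left _ (Finset.mem_sdiff.1 hx').1
  obtain ⟨y, hy⟩ : f.Nonempty := Finset.card_pos.1 (by omega)
  obtain ⟨y', hy'⟩ : f'.Nonempty := Finset.card_pos.1 (by omega)
  have hxf : x ∉ f := fun hh => hf x hh hxU
  have hxf' : x' ∉ f' := fun hh => hf' x' hh hxU'
  have l1 := LP.cons' (a := y) hr (by rw [Finset.card_insert_of_notMem hxf, hfc]) (by simp [hy]) (by simp)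
    (by rintro rfl; exact hxf hy) (by
      intro z hz hzU
      rcases Finset.mem_insert.1 hz with h1 | h1
      · exact h1
      · exact absurd (hUs hzU) (hf z h1)) hU rfl
  have l2 := LP.cons' (a := y') hr' (by rw [Finset.card_insert_of_notMem hxf', hfc']) (by simp [hy']) (by simp)
    (by rintro rfl; exact hxf' hy') (by
      intro z hz hzU
      rcases Finset.mem_insert.1 hz with h1 | h1
      · exact h1
      · exfalso
        rcases Finset.mem_union.1 hzU with h2 | h2
        · rcases Finset.mem_insert.1 h2 with h3 | h3
          · exact hf' z h1 (h3 ▸ hxU)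
          · exact hff z h3 h1
        · exact hf' z h1 (hUs h2)) l1.rev rfl
  have h3 := hno _ _ _ _ l2
  have h4 : (j + 1 + 1 + 1) * d ≤ Q * d := Nat.mul_le_mul_right _ h3
  have h5 : (j + 1 + 1 + 1) * d = (j + 1) * d + 2 * d := by ring
  omega

theorem Blob.attach1 {red : Finset V → Prop} {A R : Finset V} {a b : V} {q Q : ℕ} (hd : 2 ≤ d)
    (h : Blob d red A R a b q) (hA : 2 * d + 4 ≤ A.card)
    (hno : ∀ a b U q, LP d red a b U q → q < Q) {f : Finset V} {x x' : V}
    (hx : x ∈ A \ R) (hx' : x' ∈ A \ R) (hxx : x ≠ x') (hf : Disjoint f (A ∪ R)) 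
    (hfc : f.card = d) (hr : red (insert x f)) : (A ∪ R).card + d ≤ Q * d := by
  obtain ⟨U, j, hU, hUs, hj⟩ := h.span hd hx hx' hxx hA
  have hf := disj_out hf
  have hxU : x ∈ A ∪ R := Finset.mem_union_left _ (Finset.mem_sdiff.1 hx).1
  obtain ⟨y, hy⟩ : f.Nonempty := Finset.card_pos.1 (by omega)
  have hxf : x ∉ f := fun hh => hf x hh hxU
  have l1 := LP.cons' (a := y) hr (by rw [Finset.card_insert_of_notMem hxf, hfc]) (by simp [hy]) (by simp)
    (by rintro rfl; exact hxf hy) (by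
      intro z hz hzU
      rcases Finset.mem_insert.1 hz with h1 | h1
      · exact h1
      · exact absurd (hUs hzU) (hf z h1)) hU rfl
  have h3 := hno _ _ _ _ l1
  have h4 : (j + 1 + 1) * d ≤ Q * d := Nat.mul_le_mul_right _ h3
  have h5 : (j + 1 + 1) * d = (j + 1) * d + d := by ring
  omega

theorem Blob.attach0 {red : Finset V → Prop} {A R : Finset V} {a b : V} {q Q : ℕ} (hd : 2 ≤ d)
    (h : Blob d red A R a b q) (hA : 2 * d + 4 ≤ A.card)
    (hno : ∀ a b U q, LP d red a b U q → q < Q) : (A ∪ R).card ≤ Q * d := by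
  have h1 := h.card_core ∅
  simp only [Finset.sdiff_empty, Finset.card_empty] at h1
  obtain ⟨x, hx, x', hx', hxx⟩ := Finset.one_lt_card.1 (show 1 < (A \ R).card by omega)
  obtain ⟨U, j, hU, hUs, hj⟩ := h.span hd hx hx' hxx hA
  have h3 := hno _ _ _ _ hU
  have h4 : (j + 1) * d ≤ Q * d := Nat.mul_le_mul_right _ h3
  omega

theorem stage2 [Fintype V] {nH ρ Q : ℕ} (hd : 2 ≤ d) (H : Finset (Finset (Fin nH)))
    (hHu : IsUniformHyp (d + 1) H) (c : Finset V → Bool) (hr : chromNum H = ρ + 1)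
    (hnb : ¬ hasMonoCopy c false H)
    (hno : ∀ a b U q, LP d (fun e => c e = true) a b U q → q < Q) (L s m : ℕ)
    (hL : nH + 2 ^ nH + 8 * d + 20 ≤ L) (β : ℕ → BD V)
    (hβ : Conf d (fun e => c e = true) ρ Q L s β)
    (hN : ρ * (Q * d) + m ≤ Fintype.card V) (hm1 : sigmaNum H ≤ m)
    (hm2 : tauFn d (sigmaNum H) ≤ m + (2 * d - 1))
    (hmax : ∀ i < ρ, ∀ x x' E p, x ∈ (β i).core → x' ∈ (β i).core → x ≠ x' →
      LP d (fun e => c e = true) x x' E p → p ≤ 2 →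
      (∀ y ∈ E, y ∈ (β i).core ∨ ∀ l < ρ, y ∉ (β l).body) →
      (∃ y ∈ E, ∀ l < ρ, y ∉ (β l).body) → False) : False := by
  set red : Finset V → Prop := fun e => c e = true with hred
  obtain ⟨M, hM⟩ : ∃ M, 2 ^ nH = M := ⟨_, rfl⟩
  rw [hM] at hL
  obtain ⟨B0, hB0⟩ : ∃ B0 : Finset V, ∀ y, y ∈ B0 ↔ ∀ l < ρ, y ∉ (β l).body :=
    ⟨Finset.univ.filter (fun y => ∀ l < ρ, y ∉ (β l).body), fun y => by simp⟩
  simp only [← hB0] at hmax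
  have hcB : ∀ i < ρ, ∀ x ∈ (β i).core, x ∉ B0 := by
    intro i hi x hx hxB
    exact (hB0 x).1 hxB i hi ((β i).core_sub hx)
  have hcc : ∀ i l x, i < ρ → l < ρ → x ∈ (β i).core → x ∈ (β l).core → i = l := by
    intro i l x hi hl hx hx'
    by_contra hne
    exact disj_out (hβ.dis i l hi hl hne) x ((β i).core_sub hx) ((β l).core_sub hx')
  -- crossing
  have hcr : ∀ i l x x' E p, i < ρ → l < ρ → i ≠ l → x ∈ (β i).core → x' ∈ (β l).core →
      LP d red x x' E p → p ≤ 2 → (∀ y ∈ E, y ∈ B0 ∨ ∃ j < ρ, y ∈ (β j).core) → False := by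
    intro i l x x' E p hi hl hil hx hx' hE hp hEs
    have hEc : E.card ≤ 2 * d + 1 := by
      rw [hE.card_eq]
      have := Nat.mul_le_mul_right d hp
      omega
    have hER : ∀ j < ρ, Disjoint E (β j).R := by
      intro j hj
      rw [Finset.disjoint_left]
      intro y hy hyR
      have hyb : y ∈ (β j).body := Finset.mem_union_right _ hyR
      rcases hEs y hy with h | ⟨j', hj', h⟩
      · exact (hB0 y).1 h j hj hyb
      · by_cases hjj : j' = j
        · subst hjj
          exact (Finset.mem_sdiff.1 h).2 hyR
        · exact disj_out (hβ.dis j' j hj' hj hjj) y ((β j').core_sub h) hyb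
    have b1 := hβ.blob i hi
    have b2 := hβ.blob l hl
    have c1 := hβ.big i hi
    have c2 := hβ.big l hl
    obtain ⟨U, hU⟩ := cross (by omega) b1.clq b1.ha b1.lp b2.clq b2.ha b2.lp (hβ.dis i l hi hl hil)
      hE (Finset.mem_sdiff.1 hx).1 (Finset.mem_sdiff.1 hx').1 (hER i hi) (hER l hl)
      (by have := b1.card_core E; omega) (by have := b2.card_core E; omega)
    have h1 := hno _ _ _ _ hU
    have h2 := hβ.long i hi
    have h3 := hβ.long l hl
    omega
  let Fp : ℕ → Finset V → Prop := fun i f => f ⊆ B0 ∧ f.card = d ∧ ∃ x ∈ (β i).core,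
    ∃ x' ∈ (β i).core, x ≠ x' ∧ red (insert x f) ∧ red (insert x' f)
  -- no two meeting in one vertex
  have hF1 : ∀ i l f f', i < ρ → l < ρ → Fp i f → Fp l f' → (f ∩ f').card ≠ 1 := by
    intro i l f f' hi hl hf hf' h1
    obtain ⟨hfB, hfc, x, hx, -, -, -, hxr, -⟩ := hf
    obtain ⟨hfB', hfc', x1, hx1, x2, hx2, h12, hr1, hr2⟩ := hf'
    obtain ⟨x', hx', hxx, hxr'⟩ : ∃ x' ∈ (β l).core, x ≠ x' ∧ red (insert x' f') := by
      by_cases h : x = x1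
      · exact ⟨x2, hx2, by rw [h]; exact h12, hr2⟩
      · exact ⟨x1, hx1, h, hr1⟩
    obtain ⟨v, hv⟩ := Finset.card_eq_one.1 h1
    have hv' : ∀ y, y ∈ f → y ∈ f' → y = v := by
      intro y hy hy'
      have : y ∈ f ∩ f' := Finset.mem_inter.2 ⟨hy, hy'⟩
      rw [hv] at this
      simpa using this
    have hvf : v ∈ f ∧ v ∈ f' := by
      have : v ∈ f ∩ f' := by rw [hv]; simp
      simpa using this
    have hxB := hcB i hi x hx
    have hxB' := hcB l hl x' hx'
    have hxf : x ∉ f := fun h => hxB (hfB h)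
    have hxf' : x' ∉ f' := fun h => hxB' (hfB' h)
    have l1 : LP d red v x' (insert x' f') 1 := LP.single hxr'
      (by rw [Finset.card_insert_of_notMem hxf', hfc']) (by simp [hvf.2]) (by simp)
      (by rintro rfl; exact hxf' hvf.2)
    have l2 := LP.cons' hxr (by rw [Finset.card_insert_of_notMem hxf, hfc]) (a := x)
      (by simp) (by simp [hvf.1]) (by rintro rfl; exact hxf hvf.1) (by
        intro y hy hy'
        rcases Finset.mem_insert.1 hy with h2 | h2 <;> rcases Finset.mem_insert.1 hy' with h3 | h3
        · exact absurd (h2.symm.trans h3) hxx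
        · exact absurd (hfB' h3) (h2 ▸ hxB)
        · exact absurd (hfB h2) (h3 ▸ hxB')
        · exact hv' y h2 h3) l1 rfl
    have hmem : ∀ y ∈ insert x f ∪ insert x' f', y = x ∨ y = x' ∨ y ∈ B0 := by
      intro y hy
      simp only [Finset.mem_union, Finset.mem_insert] at hy
      rcases hy with (h | h) | (h | h)
      · tauto
      · exact Or.inr (Or.inr (hfB h))
      · tauto
      · exact Or.inr (Or.inr (hfB' h))
    by_cases hil : i = l
    · subst hil
      refine hmax i hi x x' _ _ hx hx' hxx l2 (by omega) ?_ ⟨v, by simp [hvf.1], hfB hvf.1⟩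
      intro y hy
      rcases hmem y hy with rfl | rfl | h
      · exact Or.inl hx
      · exact Or.inl hx'
      · exact Or.inr h
    · refine hcr i l x x' _ _ hi hl hil hx hx' l2 (by omega) ?_
      intro y hy
      rcases hmem y hy with rfl | rfl | h
      · exact Or.inr ⟨i, hi, hx⟩
      · exact Or.inr ⟨l, hl, hx'⟩
      · exact Or.inl h
  have hσ : sigmaNum H ≤ nH := sigma_le (by omega) H hHu (by omega)
  -- every large set contains an `F` edge
  have hF5 : ∀ W ⊆ B0, sigmaNum H ≤ W.card → ∃ i < ρ, ∃ f ⊆ W, Fp i f := by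
    intro W0 hW0 hWc0
    obtain ⟨W, hW, hWc⟩ := Finset.exists_subset_card_eq hWc0
    have hWB := hW.trans hW0
    by_contra hcon
    push Not at hcon
    let Z : ℕ → Finset V := fun i => (β i).core.filter (fun x => ∃ f ⊆ W, f.card = d ∧ red (insert x f))
    have hZ : ∀ i x, x ∈ Z i ↔ x ∈ (β i).core ∧ ∃ f ⊆ W, f.card = d ∧ red (insert x f) := by
      intro i x; simp [Z]
    have hZc : ∀ i < ρ, (Z i).card ≤ M := by
      intro i hi
      rw [← hM]
      have h1 : ∀ x, ∃ f, x ∈ Z i → f ⊆ W ∧ f.card = d ∧ red (insert x f) := by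
        intro x
        by_cases hx : x ∈ Z i
        · obtain ⟨f, hf⟩ := ((hZ i x).1 hx).2
          exact ⟨f, fun _ => hf⟩
        · exact ⟨∅, fun h => absurd h hx⟩
      choose φ hφ using h1
      have h2 : (Z i).card ≤ W.powerset.card := by
        apply Finset.card_le_card_of_injOn φ
        · intro x hx
          exact Finset.mem_coe.2 (Finset.mem_powerset.2 (hφ x hx).1)
        · intro x hx x' hx' hxx
          by_contra hne
          obtain ⟨h3, h4, h5⟩ := hφ x hx
          obtain ⟨-, -, h6⟩ := hφ x' hx'
          refine hcon i hi (φ x) (h3.trans hW) ⟨h3.trans hWB, h4, x, ((hZ i x).1 hx).1, x',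
            ((hZ i x').1 hx').1, hne, h5, ?_⟩
          rw [hxx]; exact h6
      rw [Finset.card_powerset, hWc] at h2
      exact h2.trans (Nat.pow_le_pow_right (by norm_num) hσ)
    let C : ℕ → Finset V := fun i => if i < ρ then (β i).core \ Z i else W
    have hC1 : ∀ i < ρ, C i = (β i).core \ Z i := fun i hi => if_pos hi
    have hC2 : C ρ = W := if_neg (lt_irrefl _)
    clear_value C
    have hC3 : ∀ i < ρ, ∀ x ∈ C i, x ∈ (β i).core ∧ x ∉ Z i := by
      intro i hi x hx
      rw [hC1 i hi] at hx
      simpa using hx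
    obtain ⟨e, he, hec, he1, he2⟩ := embedN (by omega) H hHu c hr hnb C (by
        intro i j hij hj
        rw [Finset.disjoint_left]
        intro x hx hx'
        have h1 := (hC3 i (by omega) x hx).1
        rcases Nat.lt_or_ge j ρ with h | h
        · have := hcc i j x (by omega) h h1 (hC3 j h x hx').1
          omega
        · have : j = ρ := by omega
          rw [this, hC2] at hx'
          exact hcB i (by omega) x h1 (hWB hx')) (by
        intro i hi
        rw [hC1 i hi]
        have h1 := hZc i hi
        have h2 := Finset.le_card_sdiff (Z i) (β i).core
        have h3 := (hβ.blob i hi).card_core ∅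
        simp only [Finset.sdiff_empty, Finset.card_empty] at h3
        have h4 := hβ.big i hi
        unfold BD.core at h2 ⊢
        omega) (by rw [hC2, hWc])
    obtain ⟨x, hx, hxW⟩ := Finset.not_subset.1 (he2 ρ le_rfl)
    have hCl : ∀ y ∈ e, y ∈ W ∨ ∃ l < ρ, y ∈ C l := by
      intro y hy
      obtain ⟨l, hl, hyl⟩ := he1 y hy
      rcases Nat.lt_or_ge l ρ with h | h
      · exact Or.inr ⟨l, h, hyl⟩
      · have : l = ρ := by omega
        rw [this, hC2] at hyl
        exact Or.inl hyl
    obtain ⟨i, hi, hxi⟩ : ∃ l < ρ, x ∈ C l := by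
      rcases hCl x hx with h | h
      · rw [hC2] at hxW; exact absurd h hxW
      · exact h
    obtain ⟨hxc, hxZ⟩ := hC3 i hi x hxi
    have hall : ∀ y ∈ e, y ∈ W ∨ y ∈ C i := by
      intro y hy
      rcases hCl y hy with h | ⟨l, hl, hyl⟩
      · exact Or.inl h
      · by_cases hil : i = l
        · subst hil; exact Or.inr hyl
        · exfalso
          have hyc := (hC3 l hl y hyl).1
          have hxy : x ≠ y := by
            rintro rfl; exact hil (hcc i l x hi hl hxc hyc)
          refine hcr i l x y e 1 hi hl hil hxc hyc (LP.single he hec hx hy hxy) (by omega) ?_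
          intro z hz
          rcases hCl z hz with h | ⟨j, hj, hzj⟩
          · exact Or.inl (hWB h)
          · exact Or.inr ⟨j, hj, (hC3 j hj z hzj).1⟩
    by_cases hsub : e.erase x ⊆ W
    · apply hxZ
      rw [hZ]
      refine ⟨hxc, e.erase x, hsub, by rw [Finset.card_erase_of_mem hx]; omega, ?_⟩
      rw [Finset.insert_erase hx]; exact he
    · obtain ⟨y, hy, hyW⟩ := Finset.not_subset.1 hsub
      rw [Finset.mem_erase] at hy
      have hyi : y ∈ C i := by
        rcases hall y hy.2 with h | h
        · exact absurd h hyW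
        · exact h
      obtain ⟨z, hz, hzi⟩ := Finset.not_subset.1 (he2 i hi.le)
      have hzW : z ∈ W := by
        rcases hall z hz with h | h
        · exact h
        · exact absurd h hzi
      refine hmax i hi x y e 1 hxc (hC3 i hi y hyi).1 hy.1.symm (LP.single he hec hx hy.2 hy.1.symm)
        (by omega) ?_ ⟨z, hz, hWB hzW⟩
      intro v hv
      rcases hall v hv with h | h
      · exact Or.inr (hWB h)
      · exact Or.inl (hC3 i hi v h).1
  -- counting
  have hcount : Fintype.card V ≤ B0.card + ∑ i ∈ Finset.range ρ, (β i).body.card := by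
    rw [← Finset.card_univ]
    refine le_trans (Finset.card_le_card (t := B0 ∪ (Finset.range ρ).biUnion (fun i => (β i).body)) ?_)
      ((Finset.card_union_le _ _).trans (Nat.add_le_add_left Finset.card_biUnion_le _))
    intro y _
    by_cases hy : y ∈ B0
    · exact Finset.mem_union_left _ hy
    · rw [hB0] at hy
      push Not at hy
      obtain ⟨l, hl, hyl⟩ := hy
      exact Finset.mem_union_right _ (Finset.mem_biUnion.2 ⟨l, Finset.mem_range.2 hl, hyl⟩)
  have hB0d : ∀ f ⊆ B0, ∀ i < ρ, Disjoint f (β i).body := by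
    intro f hf i hi
    rw [Finset.disjoint_left]
    intro y hy
    exact (hB0 y).1 (hf hy) i hi
  have hbig : ∀ i < ρ, 2 * d + 4 ≤ (β i).A.card := by
    intro i hi
    have := hβ.big i hi
    omega
  have hdisj : ∀ i < ρ, ∀ f f', Fp i f → Fp i f' → ¬ Disjoint f f' := by
    intro i hi f f' hf hf' hff
    have h2d : (β i).body.card + 2 * d ≤ Q * d := by
      obtain ⟨hfB, hfc, x, hx, -, -, -, hxr, -⟩ := hf
      obtain ⟨hfB', hfc', x1, hx1, x2, hx2, h12, hr1, hr2⟩ := hf'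
      obtain ⟨x', hx', hxx, hxr'⟩ : ∃ x' ∈ (β i).core, x ≠ x' ∧ red (insert x' f') := by
        by_cases h : x = x1
        · exact ⟨x2, hx2, by rw [h]; exact h12, hr2⟩
        · exact ⟨x1, hx1, h, hr1⟩
      exact ((hβ.blob i hi).attach2 hd (hbig i hi) hno hx hx' hxx (hB0d f hfB i hi) (hB0d f' hfB' i hi)
        hff hfc hfc' hxr hxr').1
    have hsum : ∑ l ∈ Finset.range ρ, ((β l).body.card + if l = i then 2 * d else 0) ≤
        ∑ l ∈ Finset.range ρ, Q * d := by
      apply Finset.sum_le_sum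
      intro l hl
      rw [Finset.mem_range] at hl
      split_ifs with h
      · rw [h]; exact h2d
      · exact (hβ.blob l hl).attach0 hd (hbig l hl) hno
    rw [Finset.sum_add_distrib, Finset.sum_ite_eq' , if_pos (Finset.mem_range.2 hi), Finset.sum_const,
      Finset.card_range, smul_eq_mul] at hsum
    let F : Finset (Finset V) := B0.powerset.filter (fun f => ∃ i < ρ, Fp i f)
    have hF : ∀ f, f ∈ F ↔ ∃ i < ρ, Fp i f := by
      intro f
      simp only [F, Finset.mem_filter, Finset.mem_powerset]
      constructor
      · exact fun h => h.2
      · rintro ⟨i, hi, h⟩; exact ⟨h.1, i, hi, h⟩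
    obtain ⟨W, hWB, hWc, hW⟩ := tau_use hd F B0 (σ := sigmaNum H) (by omega)
      (fun f hf => by obtain ⟨i, hi, h⟩ := (hF f).1 hf; exact h.2.1)
      (fun f hf => by obtain ⟨i, hi, h⟩ := (hF f).1 hf; exact h.1)
      (fun f hf f' hf' => by
        obtain ⟨i, hi, h⟩ := (hF f).1 hf
        obtain ⟨i', hi', h'⟩ := (hF f').1 hf'
        exact hF1 i i' f f' hi hi' h h')
    obtain ⟨l, hl, f, hfW, hlf⟩ := hF5 W hWB hWc.ge
    exact hW f ((hF f).2 ⟨l, hl, hlf⟩) hfW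
  have hφ : ∀ l, ∃ φ : Finset V, (Fp l φ ∨ (φ = ∅ ∧ ∀ f, ¬ Fp l f)) := by
    intro l
    by_cases h : ∃ f, Fp l f
    · obtain ⟨f, hf⟩ := h; exact ⟨f, Or.inl hf⟩
    · push Not at h; exact ⟨∅, Or.inr ⟨rfl, h⟩⟩
  choose φ hφ using hφ
  have hsum : ∑ l ∈ Finset.range ρ, ((β l).body.card + (φ l).card) ≤ ∑ l ∈ Finset.range ρ, Q * d := by
    apply Finset.sum_le_sum
    intro l hl
    rw [Finset.mem_range] at hl
    rcases hφ l with h | h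
    · obtain ⟨hfB, hfc, x, hx, x', hx', hxx, hxr, -⟩ := h
      rw [hfc]
      exact (hβ.blob l hl).attach1 hd (hbig l hl) hno hx hx' hxx (hB0d _ hfB l hl) hfc hxr
    · rw [h.1, Finset.card_empty, add_zero]
      exact (hβ.blob l hl).attach0 hd (hbig l hl) hno
  rw [Finset.sum_add_distrib, Finset.sum_const, Finset.card_range, smul_eq_mul] at hsum
  have h1 := Finset.le_card_sdiff ((Finset.range ρ).biUnion φ) B0
  have h2 : ((Finset.range ρ).biUnion φ).card ≤ _ := Finset.card_biUnion_le
  obtain ⟨i, hi, f, hf, hfi⟩ := hF5 (B0 \ (Finset.range ρ).biUnion φ) Finset.sdiff_subset (by omega)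
  rcases hφ i with h | h
  · apply hdisj i hi f (φ i) hfi h
    rw [Finset.disjoint_left]
    intro y hy hy'
    have := hf hy
    rw [Finset.mem_sdiff] at this
    exact this.2 (Finset.mem_biUnion.2 ⟨i, Finset.mem_range.2 hi, hy'⟩)
  · exact h.2 f hfi

end Stage2

theorem stage2_iter {V : Type} [DecidableEq V] [Fintype V] {d nH ρ Q : ℕ} (hd : 2 ≤ d)
    (H : Finset (Finset (Fin nH)))
    (hHu : IsUniformHyp (d + 1) H) (c : Finset V → Bool) (hr : chromNum H = ρ + 1)
    (hnb : ¬ hasMonoCopy c false H)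
    (hno : ∀ a b U q, LP d (fun e => c e = true) a b U q → q < Q) (L s m G : ℕ)
    (hL : nH + 2 ^ nH + 8 * d + 20 + (3 * d + 2) * (G + 1) ≤ L) (β : ℕ → BD V)
    (hβ : Conf d (fun e => c e = true) ρ Q L s β) (hs : ρ * (Q * d) ≤ s + G)
    (hN : ρ * (Q * d) + m ≤ Fintype.card V) (hm1 : sigmaNum H ≤ m)
    (hm2 : tauFn d (sigmaNum H) ≤ m + (2 * d - 1)) : False := by
  have main : ∀ g, g ≤ G + 1 → ∃ β : ℕ → BD V,
      Conf d (fun e => c e = true) ρ Q (L - (3 * d + 2) * g) (s + g) β := by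
    intro g
    induction g with
    | zero => intro _; exact ⟨β, by simpa using hβ⟩
    | succ g ih =>
      intro hg
      obtain ⟨β, hβ⟩ := ih (by omega)
      have hLg : (3 * d + 2) * g ≤ (3 * d + 2) * (G + 1) := Nat.mul_le_mul_left _ (by omega)
      have hLg' : (3 * d + 2) * (g + 1) = (3 * d + 2) * g + (3 * d + 2) := by ring
      by_contra hcon
      refine stage2 hd H hHu c hr hnb hno _ _ m (by omega) β hβ hN hm1 hm2 ?_
      intro i hi x x' E p hx hx' hxx hE hp hEs hEB
      apply hcon
      have hEc : E.card ≤ 2 * d + 1 := by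
        rw [hE.card_eq]
        have := Nat.mul_le_mul_right d hp
        omega
      have hbig := hβ.big i hi
      obtain ⟨M, hM⟩ : ∃ M, 2 ^ nH = M := ⟨_, rfl⟩
      rw [hM] at hL
      obtain ⟨A', R', a', q', hb, hun, hq, hAc⟩ := (hβ.blob i hi).insertE hd
        (Finset.mem_sdiff.1 hx).1 (Finset.mem_sdiff.1 hx').1 hxx hE (by
          rw [Finset.disjoint_left]
          intro y hy hyR
          rcases hEs y hy with h | h
          · exact (Finset.mem_sdiff.1 h).2 hyR
          · exact h i hi (Finset.mem_union_right _ hyR)) (by omega)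
      have hup : ∀ l, l ≠ i → Function.update β i ⟨A', R', a', (β i).b, q'⟩ l = β l :=
        fun l hl => Function.update_of_ne hl _ _
      have hup' : Function.update β i ⟨A', R', a', (β i).b, q'⟩ i = ⟨A', R', a', (β i).b, q'⟩ :=
        Function.update_self _ _ _
      have hbody : (Function.update β i ⟨A', R', a', (β i).b, q'⟩ i).body = (β i).body ∪ E := by
        rw [hup']; exact hun
      have hdis : ∀ l, l < ρ → l ≠ i → Disjoint ((β i).body ∪ E) (β l).body := by
        intro l hl hli
        rw [Finset.disjoint_union_left]
        refine ⟨hβ.dis i l hi hl hli.symm, ?_⟩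
        rw [Finset.disjoint_left]
        intro y hy hyl
        rcases hEs y hy with h | h
        · exact disj_out (hβ.dis i l hi hl hli.symm) y ((β i).core_sub h) hyl
        · exact h l hl hyl
      refine ⟨Function.update β i ⟨A', R', a', (β i).b, q'⟩, ?_, ?_, ?_, ?_, ?_⟩
      · intro l hl
        by_cases hli : l = i
        · subst hli; rw [hup']; exact hb
        · rw [hup l hli]; exact hβ.blob l hl
      · intro j l hj hl hjl
        by_cases hji : j = i
        · subst hji
          rw [hbody, hup l hjl.symm]
          exact hdis l hl hjl.symm
        · by_cases hli : l = i
          · subst hli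
            rw [hbody, hup j hji]
            exact (hdis j hj hji).symm
          · rw [hup j hji, hup l hli]; exact hβ.dis j l hj hl hjl
      · intro l hl
        by_cases hli : l = i
        · subst hli; rw [hup']; simp only; omega
        · rw [hup l hli]
          have := hβ.big l hl
          omega
      · intro l hl
        by_cases hli : l = i
        · subst hli; rw [hup']; simp only
          have := hβ.long l hl
          omega
        · rw [hup l hli]; exact hβ.long l hl
      · have h1 := hβ.sum
        have h2 : ∑ l ∈ Finset.range ρ, (β l).body.card <
            ∑ l ∈ Finset.range ρ, (Function.update β i ⟨A', R', a', (β i).b, q'⟩ l).body.card := by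
          apply Finset.sum_lt_sum
          · intro l _
            by_cases hli : l = i
            · subst hli; rw [hbody]; exact Finset.card_le_card Finset.subset_union_left
            · rw [hup l hli]
          · refine ⟨i, Finset.mem_range.2 hi, ?_⟩
            rw [hbody]
            apply Finset.card_lt_card
            rw [Finset.ssubset_iff_of_subset Finset.subset_union_left]
            obtain ⟨y, hy, hyB⟩ := hEB
            exact ⟨y, Finset.mem_union_right _ hy, hyB i hi⟩
        omega
  obtain ⟨β', hβ'⟩ := main (G + 1) le_rfl
  have h1 := hβ'.sum
  have h2 : ∑ l ∈ Finset.range ρ, (β' l).body.card ≤ ∑ l ∈ Finset.range ρ, Q * d := by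
    apply Finset.sum_le_sum
    intro l hl
    rw [Finset.mem_range] at hl
    refine (hβ'.blob l hl).attach0 hd ?_ hno
    have := hβ'.big l hl
    obtain ⟨M, hM⟩ : ∃ M, 2 ^ nH = M := ⟨_, rfl⟩
    rw [hM] at hL
    omega
  rw [Finset.sum_const, Finset.card_range, smul_eq_mul] at h2
  omega

theorem main_contra {V : Type} [DecidableEq V] [Fintype V] {d nH ρ Q : ℕ} (hd : 2 ≤ d) (hρ : 1 ≤ ρ)
    (H : Finset (Finset (Fin nH)))
    (hHu : IsUniformHyp (d + 1) H) (c : Finset V → Bool) (hr : chromNum H = ρ + 1)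
    (hnb : ¬ hasMonoCopy c false H)
    (hno : ∀ a b U q, LP d (fun e => c e = true) a b U q → q < Q) (m : ℕ)
    (hN : ρ * (Q * d) + m ≤ Fintype.card V) (hm1 : sigmaNum H ≤ m)
    (hm2 : tauFn d (sigmaNum H) ≤ m + (2 * d - 1)) (Dn : ℕ → ℕ)
    (hDn : ∀ t, ∀ X : Finset V, Dn t ≤ X.card → ∃ K ⊆ X, K.card = t ∧ Clq d (fun e => c e = true) K)
    (T0 Tm G T' : ℕ) (hT0 : T0 = nH + 2 * d + 4) (hTm : Tm = T0 + (d + 1) * ρ)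
    (hG : G = Dn Tm + ρ * Tm)
    (hT' : T' = nH + 2 ^ nH + 8 * d + 20 + (3 * d + 2) * (G + 1) + (d + 1))
    (hQ : 2 * (Dn Tm + Dn (Tm + T' + d) + ρ * (Tm + T') + 1) ≤ Q * d) : False := by
  have hT'' : nH + 2 * d + 4 ≤ T' := by
    obtain ⟨M, hM⟩ : ∃ M, 2 ^ nH = M := ⟨_, rfl⟩
    rw [hM] at hT'
    omega
  obtain ⟨P, X, hX, hP, hPd, hPc⟩ := stage1 hd hρ H hHu c hr hnb hno T0 T' (by omega) (by omega) Dn hDn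
    (by omega) Tm hTm (by omega)
  have hTi : ∀ i, i < ρ → T0 + (d + 1) * i ≤ Tm := by
    intro i hi
    have := Nat.mul_le_mul_left (d + 1) hi.le
    omega
  have hPq : ∀ i < ρ, Q ≤ 2 * (P i).q := by
    intro i hi
    have hsum : ∑ l ∈ Finset.range ρ, ((P l).supp.card + if l = i then Q * d else 0) ≤
        ∑ l ∈ Finset.range ρ, ((Q * d + (Tm + T')) + if l = i then (P i).q * d + 1 else 0) := by
      apply Finset.sum_le_sum
      intro l hl
      rw [Finset.mem_range] at hl
      have h0 := hTi l hl
      split_ifs with h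
      · subst h
        have h1 := Finset.card_union_le ((P l).A ∪ (P l).U) (P l).Y
        have h2 := Finset.card_union_le (P l).A (P l).U
        have h3 := (hP l hl).lp.card_eq
        have h4 := (hP l hl).cardA
        have h5 := (hP l hl).cardY
        unfold SD.supp
        omega
      · have := (hP l hl).supp_card (by omega) hno
        omega
    rw [Finset.sum_add_distrib, Finset.sum_add_distrib, Finset.sum_ite_eq', Finset.sum_ite_eq',
      if_pos (Finset.mem_range.2 hi), if_pos (Finset.mem_range.2 hi), Finset.sum_const,
      Finset.card_range, smul_eq_mul] at hsum
    have h1 : ρ * (Q * d + (Tm + T')) = ρ * (Q * d) + ρ * (Tm + T') := by ring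
    have h2 : Q * d ≤ 2 * (P i).q * d := by
      have : 2 * (P i).q * d = 2 * ((P i).q * d) := by ring
      omega
    exact Nat.le_of_mul_le_mul_right h2 (by omega)
  have hcl := closing hd H hHu c hr hnb hno (fun i => T0 + (d + 1) * i) T'
    (fun i hi => by omega) hT'' P hP hPd hPq
  have hex : ∀ i, ∃ D : BD V, i < ρ → Blob d (fun e => c e = true) D.A D.R D.a D.b D.q ∧
      D.body ⊆ (P i).supp ∧ (P i).supp.card ≤ D.body.card + (T0 + (d + 1) * i) ∧
      T' ≤ D.A.card + (d + 1) ∧ (P i).q ≤ D.q := by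
    intro i
    by_cases hi : i < ρ
    · obtain ⟨A, R, a, b, q, h⟩ := hcl i hi
      exact ⟨⟨A, R, a, b, q⟩, fun _ => h⟩
    · exact ⟨⟨∅, ∅, (P i).a, (P i).a, 0⟩, fun h => absurd h hi⟩
  choose β hβ using hex
  have hs : ∑ i ∈ Finset.range ρ, (P i).supp.card ≤ ∑ i ∈ Finset.range ρ, ((β i).body.card + Tm) := by
    apply Finset.sum_le_sum
    intro l hl
    rw [Finset.mem_range] at hl
    have := (hβ l hl).2.2.1
    have := hTi l hl
    omega
  rw [Finset.sum_add_distrib, Finset.sum_const, Finset.card_range, smul_eq_mul] at hs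
  refine stage2_iter hd H hHu c hr hnb hno (T' - (d + 1)) (∑ i ∈ Finset.range ρ, (β i).body.card) m G
    (by rw [hT']; omega) β ⟨fun i hi => (hβ i hi).1, ?_, ?_, ?_, le_rfl⟩ (by omega) hN hm1 hm2
  · intro i j hi hj hij
    refine Finset.disjoint_of_subset_left (hβ i hi).2.1
      (Finset.disjoint_of_subset_right (hβ j hj).2.1 ?_)
    rcases lt_or_gt_of_ne hij with h | h
    · exact hPd i j h hj
    · exact (hPd j i h hi).symm
  · intro i hi
    have := (hβ i hi).2.2.2.1
    omega
  · intro i hi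
    have := (hβ i hi).2.2.2.2
    have := hPq i hi
    omega

theorem blue_clique {k nH : ℕ} (H : Finset (Finset (Fin nH))) (hHu : IsUniformHyp k H)
    {V : Type} [DecidableEq V] (c : Finset V → Bool) (Y : Finset V) (hY : Y.card = nH)
    (h : ∀ e ⊆ Y, e.card = k → c e = false) : hasMonoCopy c false H := by
  let f : Fin nH → V := fun i => (Y.equivFin.symm (Fin.cast hY.symm i) : V)
  have hf : Function.Injective f := by
    intro i j hij
    have h1 := Y.equivFin.symm.injective (Subtype.ext hij)
    exact Fin.ext (by simpa [Fin.ext_iff] using h1)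
  refine ⟨f, hf, ?_⟩
  intro e he
  apply h
  · intro x hx
    obtain ⟨i, _, rfl⟩ := Finset.mem_image.1 hx
    exact (Y.equivFin.symm (Fin.cast hY.symm i)).2
  · rw [Finset.card_image_of_injective _ hf, hHu e he]

/-- Upper bound for loose paths:
`R(P_{n,1}^{(k)}, H) ≤ (χ(H)-1)(n-1) + max{τ(k-1, σ(H)) - 2k + 3, σ(H)}`
for all large `n ≡ 1 (mod k-1)`. -/
theorem loosePath_upper {k nH : ℕ} (hk : 3 ≤ k)
    (H : Finset (Finset (Fin nH))) (hHu : IsUniformHyp k H) :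
    ∃ n₀ : ℕ, ∀ n : ℕ, n₀ ≤ n → n ≡ 1 [MOD k - 1] →
      ramseyNumber (ellPathEdges k 1 n) H ≤
        (chromNum H - 1) * (n - 1) +
          max (tauFn (k - 1) (sigmaNum H) - (2 * k - 3)) (sigmaNum H) := by
  obtain ⟨d, rfl⟩ : ∃ d, k = d + 1 := ⟨k - 1, by omega⟩
  have hd : 2 ≤ d := by omega
  have hk2 : 2 ≤ d + 1 := by omega
  have hram := fun t => ramsey_hyp (d + 1) t nH
  choose Dn hDn using hram
  obtain ⟨Tm, hTm⟩ : ∃ Tm, Tm = nH + 2 * d + 4 + (d + 1) * (chromNum H - 1) := ⟨_, rfl⟩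
  obtain ⟨G, hG⟩ : ∃ G, G = Dn Tm + (chromNum H - 1) * Tm := ⟨_, rfl⟩
  obtain ⟨T', hT'⟩ : ∃ T', T' = nH + 2 ^ nH + 8 * d + 20 + (3 * d + 2) * (G + 1) + (d + 1) := ⟨_, rfl⟩
  refine ⟨2 * (Dn Tm + Dn (Tm + T' + d) + (chromNum H - 1) * (Tm + T') + 1) + 1, ?_⟩
  intro n hn hmod
  apply Nat.sInf_le
  intro c
  rw [Nat.add_sub_cancel] at hmod
  obtain ⟨Q, hQ⟩ : ∃ Q, n = Q * d + 1 := by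
    have h1 : d ∣ n - 1 := (Nat.modEq_iff_dvd' (by omega)).1 hmod.symm
    obtain ⟨Q, hQ⟩ := h1
    exact ⟨Q, by rw [mul_comm Q d]; omega⟩
  by_contra hcon
  rw [not_or] at hcon
  obtain ⟨hred, hnb⟩ := hcon
  have hno : ∀ a b U q, LP d (fun e => c e = true) a b U q → q < Q := by
    intro a b U q h
    by_contra hq
    exact hred (LP.monoCopy (by omega) h (not_lt.1 hq) hQ)
  obtain ⟨χ, hχ⟩ : ∃ χ, chromNum H = χ := ⟨_, rfl⟩
  have hm1 := le_max_right (tauFn (d + 1 - 1) (sigmaNum H) - (2 * (d + 1) - 3)) (sigmaNum H)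
  have hm2 := le_max_left (tauFn (d + 1 - 1) (sigmaNum H) - (2 * (d + 1) - 3)) (sigmaNum H)
  rcases χ with _ | ρ
  · obtain ⟨φ, -⟩ := chrom_att hk2 H hHu
    rw [hχ] at φ
    have hempty : ∀ v : Fin nH, False := fun v => (φ v).elim0
    apply hnb
    refine ⟨fun v => (hempty v).elim, fun v => (hempty v).elim, ?_⟩
    intro e he
    obtain ⟨v, hv⟩ : e.Nonempty := Finset.card_pos.1 (by rw [hHu e he]; omega)
    exact (hempty v).elim
  · rcases Nat.eq_zero_or_pos ρ with h0 | hρ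
    · subst h0
      obtain ⟨e, -, -, -, he⟩ := embedN hk2 H hHu c hχ hnb (fun _ => Finset.univ)
        (fun i j hij hj => by omega) (fun i hi => by omega)
        (by rw [Finset.card_univ, Fintype.card_fin]; omega)
      exact he 0 le_rfl (Finset.subset_univ _)
    · have hχ' : chromNum H - 1 = ρ := by omega
      refine main_contra hd hρ H hHu c hχ hnb hno
        (max (tauFn (d + 1 - 1) (sigmaNum H) - (2 * (d + 1) - 3)) (sigmaNum H)) ?_ hm1 ?_ Dn ?_
        _ Tm G T' rfl (by rw [hTm, hχ']) (by rw [hG, hχ']) hT' (by rw [← hχ']; omega)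
      · rw [Fintype.card_fin, hχ', hQ, show Q * d + 1 - 1 = Q * d by omega]
      · rw [Nat.add_sub_cancel] at hm2 ⊢
        omega
      · intro t X hX
        rcases hDn t c X hX with ⟨K, h1, h2, h3⟩ | ⟨K, h1, h2, h3⟩
        · exact ⟨K, h1, h2, h3⟩
        · exact absurd (blue_clique H hHu c K h2 h3) hnb
end
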